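/- arXiv:2007.04918 — 2 statements merged into one kernel-verified Lean document; each statement's English description precedes it below -/
import Mathlib

section
/- Let d ∈ {2, 3}. Fix p ≥ 1, ε > 0, constants 0 < c₁ < c₂, and a coordinate index j ∈ {1, …, d}. Let u be an admissible smooth solution on [2,∞) of the d-dimensional Zakharov–Kuznetsov equation with sup_{t≥2} (‖u(t,·)‖_{L²(ℝ^d)} + ‖∇u(t,·)‖_{L²(ℝ^d)}) < ∞. For t ≥ 2 set Ω_j(t) = { x ∈ ℝ^d : c₁ t^p (log t)^{1+ε} ≤ |x_j| ≤ c₂ t^p (log t)^{1+ε} }. Then lim_{t→∞} ∫_{Ω_j(t)} u(t,x)² dx = 0. -/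
open MeasureTheory Filter

noncomputable section

/-- Partial derivative in time of a function `u(t,x)` with `x ∈ ℝ^d`. -/
def ptd {d : ℕ} (u : ℝ → EuclideanSpace ℝ (Fin d) → ℝ) :
    ℝ → EuclideanSpace ℝ (Fin d) → ℝ :=
  fun t x => deriv (fun s => u s x) t

/-- Partial derivative in the `j`-th space coordinate of a function `u(t,x)`. -/
def pcd {d : ℕ} (j : Fin d) (u : ℝ → EuclideanSpace ℝ (Fin d) → ℝ) :
    ℝ → EuclideanSpace ℝ (Fin d) → ℝ :=
  fun t x => fderiv ℝ (fun y => u t y) x (EuclideanSpace.single j 1)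

/-- Iterated partial derivatives of `u(t,x)`, indexed by a list of directions
(`none` = time, `some j` = the `j`-th space coordinate). -/
def Dd {d : ℕ} (u : ℝ → EuclideanSpace ℝ (Fin d) → ℝ) :
    List (Option (Fin d)) → (ℝ → EuclideanSpace ℝ (Fin d) → ℝ)
  | [] => u
  | none :: l => ptd (Dd u l)
  | some j :: l => pcd j (Dd u l)

/-- An admissible smooth solution of the `d`-dimensional Zakharov–Kuznetsov equation
`∂ₜu + ∂_{x₁}(Δu) + u ∂_{x₁}u = 0` on `[2,∞)` (`j₀` is the first coordinate index):
it is `C^∞`, solves the equation pointwise for `t ≥ 2`, and all iterated partial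
derivatives decay in space faster than any polynomial, locally uniformly in time. -/
structure IsAdmissibleZKd (d : ℕ) (j₀ : Fin d)
    (u : ℝ → EuclideanSpace ℝ (Fin d) → ℝ) : Prop where
  smooth : ContDiff ℝ (⊤ : ℕ∞) (fun p : ℝ × EuclideanSpace ℝ (Fin d) => u p.1 p.2)
  eqn : ∀ (t : ℝ) (x : EuclideanSpace ℝ (Fin d)), 2 ≤ t →
    ptd u t x
      + pcd j₀ (fun t' x' => ∑ i : Fin d, pcd i (pcd i u) t' x') t x
      + u t x * pcd j₀ u t x = 0
  decay : ∀ (l : List (Option (Fin d))) (N : ℕ) (a b : ℝ), 2 ≤ a →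
    ∃ C : ℝ, ∀ (t : ℝ) (x : EuclideanSpace ℝ (Fin d)), t ∈ Set.Icc a b →
      (1 + ‖x‖) ^ N * |Dd u l t x| ≤ C

/-- Continuous functions decaying faster than any polynomial. -/
structure IsRapidlyDecaying {E : Type*} [NormedAddCommGroup E] (f : E → ℝ) : Prop where
  continuous : Continuous f
  decay : ∀ N : ℕ, ∃ C : ℝ, ∀ x, (1 + ‖x‖) ^ N * |f x| ≤ C

namespace IsRapidlyDecaying

section

variable {E : Type*} [NormedAddCommGroup E] {f g : E → ℝ}

lemma mul_bounded (hf : IsRapidlyDecaying f) (hg : Continuous g) {M : ℝ}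
    (hM : ∀ x, |g x| ≤ M) : IsRapidlyDecaying (fun x => f x * g x) := by
  refine ⟨hf.continuous.mul hg, fun N => ?_⟩
  obtain ⟨C, hC⟩ := hf.decay N
  refine ⟨C * M, fun x => ?_⟩
  rw [abs_mul, ← mul_assoc]
  exact mul_le_mul (hC x) (hM x) (abs_nonneg _) (le_trans (by positivity) (hC x))

lemma bounded_mul (hf : IsRapidlyDecaying f) (hg : Continuous g) {M : ℝ}
    (hM : ∀ x, |g x| ≤ M) : IsRapidlyDecaying (fun x => g x * f x) := by
  simpa only [mul_comm] using hf.mul_bounded hg hM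

lemma bounded (hf : IsRapidlyDecaying f) : ∃ C, ∀ x, |f x| ≤ C := by
  simpa using hf.decay 0

lemma mul (hf : IsRapidlyDecaying f) (hg : IsRapidlyDecaying g) :
    IsRapidlyDecaying (fun x => f x * g x) :=
  hf.mul_bounded hg.continuous hg.bounded.choose_spec

lemma add (hf : IsRapidlyDecaying f) (hg : IsRapidlyDecaying g) :
    IsRapidlyDecaying (fun x => f x + g x) := by
  refine ⟨hf.continuous.add hg.continuous, fun N => ?_⟩
  obtain ⟨C, hC⟩ := hf.decay N
  obtain ⟨D, hD⟩ := hg.decay N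
  refine ⟨C + D, fun x => ?_⟩
  calc (1 + ‖x‖) ^ N * |f x + g x| ≤ (1 + ‖x‖) ^ N * (|f x| + |g x|) := by
        gcongr; exact abs_add_le _ _
    _ ≤ C + D := by rw [mul_add]; exact add_le_add (hC x) (hD x)

lemma const_mul (hf : IsRapidlyDecaying f) (c : ℝ) : IsRapidlyDecaying (fun x => c * f x) := by
  simpa only [mul_comm] using hf.mul_bounded (g := fun _ => c) continuous_const fun _ => le_rfl

lemma sq (hf : IsRapidlyDecaying f) : IsRapidlyDecaying (fun x => f x ^ 2) := by
  simpa only [pow_two] using hf.mul hf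

lemma abs (hf : IsRapidlyDecaying f) : IsRapidlyDecaying (fun x => |f x|) :=
  ⟨hf.continuous.abs, by simpa using hf.decay⟩

lemma finset_sum {ι : Type*} (s : Finset ι) {F : ι → E → ℝ}
    (hF : ∀ i ∈ s, IsRapidlyDecaying (F i)) : IsRapidlyDecaying (fun x => ∑ i ∈ s, F i x) := by
  classical
  induction s using Finset.induction_on with
  | empty => exact ⟨by simpa using continuous_const, fun N => ⟨0, by simp⟩⟩
  | insert i s hi ih =>
    simp only [Finset.sum_insert hi]
    exact (hF i (by simp)).add (ih fun k hk => hF k (by simp [hk]))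

end

lemma integrable {E : Type*} [NormedAddCommGroup E] [NormedSpace ℝ E] [FiniteDimensional ℝ E]
    [MeasurableSpace E] [BorelSpace E] {μ : Measure E} [μ.IsAddHaarMeasure] {f : E → ℝ}
    (hf : IsRapidlyDecaying f) : Integrable f μ := by
  obtain ⟨C, hC⟩ := hf.decay (Module.finrank ℝ E + 1)
  have h := (integrable_one_add_norm (μ := μ) (E := E) (r := ((Module.finrank ℝ E + 1 : ℕ) : ℝ))
    (by push_cast; linarith)).const_mul C
  refine h.mono' hf.continuous.aestronglyMeasurable (ae_of_all _ fun x => ?_)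
  have hx : 0 < 1 + ‖x‖ := by positivity
  rw [Real.rpow_neg hx.le, Real.rpow_natCast, Real.norm_eq_abs, ← div_eq_mul_inv,
    le_div_iff₀ (by positivity), mul_comm]
  exact hC x

end IsRapidlyDecaying

/-- The `i`-th partial derivative of a function on `ℝ^d`. -/
def partialDeriv {d : ℕ} (i : Fin d) (f : EuclideanSpace ℝ (Fin d) → ℝ) :
    EuclideanSpace ℝ (Fin d) → ℝ :=
  fun x => fderiv ℝ f x (EuclideanSpace.single i 1)

section PartialDeriv

variable {d : ℕ} {f g : EuclideanSpace ℝ (Fin d) → ℝ}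

lemma partialDeriv_mul (i : Fin d) (hf : Differentiable ℝ f) (hg : Differentiable ℝ g) :
    partialDeriv i (fun x => f x * g x)
      = fun x => partialDeriv i f x * g x + f x * partialDeriv i g x := by
  ext x
  simp only [partialDeriv]
  rw [fderiv_fun_mul (hf x) (hg x)]
  simp
  ring

lemma partialDeriv_add (i : Fin d) (hf : Differentiable ℝ f) (hg : Differentiable ℝ g) :
    partialDeriv i (fun x => f x + g x) = fun x => partialDeriv i f x + partialDeriv i g x := by
  ext x
  simp only [partialDeriv]
  rw [fderiv_fun_add (hf x) (hg x)]
  simp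

lemma partialDeriv_sum (i : Fin d) {ι : Type*} (s : Finset ι)
    {F : ι → EuclideanSpace ℝ (Fin d) → ℝ} (hF : ∀ k ∈ s, Differentiable ℝ (F k)) :
    partialDeriv i (fun x => ∑ k ∈ s, F k x) = fun x => ∑ k ∈ s, partialDeriv i (F k) x := by
  ext x
  simp only [partialDeriv]
  rw [fderiv_fun_sum fun k hk => hF k hk x]
  simp

lemma ContDiff.partialDeriv (i : Fin d) (hf : ContDiff ℝ (⊤ : ℕ∞) f) :
    ContDiff ℝ (⊤ : ℕ∞) (partialDeriv i f) :=
  (hf.fderiv_right (m := (⊤ : ℕ∞)) (by simp)).clm_apply contDiff_const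

lemma partialDeriv_comm (i k : Fin d) (hf : ContDiff ℝ (⊤ : ℕ∞) f) :
    partialDeriv i (partialDeriv k f) = partialDeriv k (partialDeriv i f) := by
  have hd : Differentiable ℝ (fderiv ℝ f) :=
    (hf.fderiv_right (m := (⊤ : ℕ∞)) (by simp)).differentiable (by simp)
  have h (a b : Fin d) (x) : partialDeriv a (partialDeriv b f) x
      = fderiv ℝ (fderiv ℝ f) x (EuclideanSpace.single a 1) (EuclideanSpace.single b 1) := by
    change fderiv ℝ (fun y => fderiv ℝ f y (EuclideanSpace.single b 1)) x _ = _
    rw [fderiv_clm_apply (hd x) (by fun_prop)]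
    simp
  ext x
  rw [h, h]
  exact second_derivative_symmetric (fun y => (hf.differentiable (by simp) y).hasFDerivAt)
    (hd x).hasFDerivAt _ _

lemma abs_partialDeriv_le (i : Fin d) (x : EuclideanSpace ℝ (Fin d)) :
    |partialDeriv i f x| ≤ ‖fderiv ℝ f x‖ := by
  simpa [partialDeriv] using (fderiv ℝ f x).le_opNorm (EuclideanSpace.single i 1)

lemma norm_fderiv_le_sum_abs_partialDeriv (x : EuclideanSpace ℝ (Fin d)) :
    ‖fderiv ℝ f x‖ ≤ ∑ i, |partialDeriv i f x| := by
  refine ContinuousLinearMap.opNorm_le_bound _ (Finset.sum_nonneg fun _ _ => abs_nonneg _)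
    fun y => ?_
  have hy : y = ∑ i, y i • EuclideanSpace.single i (1 : ℝ) := by
    ext k
    simp [Finset.sum_apply, Pi.single_apply]
  conv_lhs => rw [hy]
  rw [map_sum, Finset.sum_mul]
  refine (norm_sum_le _ _).trans (Finset.sum_le_sum fun i _ => ?_)
  rw [map_smul, norm_smul, mul_comm]
  exact mul_le_mul_of_nonneg_left (PiLp.norm_apply_le y i) (abs_nonneg _)

end PartialDeriv

/-- Smooth functions on `ℝ^d` all of whose iterated partial derivatives decay rapidly. -/
structure IsSchwartzFun {d : ℕ} (f : EuclideanSpace ℝ (Fin d) → ℝ) : Prop where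
  smooth : ContDiff ℝ (⊤ : ℕ∞) f
  rapid : ∀ l : List (Fin d), IsRapidlyDecaying (l.foldr partialDeriv f)

namespace IsSchwartzFun

variable {d : ℕ} {f : EuclideanSpace ℝ (Fin d) → ℝ}

lemma isRapidlyDecaying (hf : IsSchwartzFun f) : IsRapidlyDecaying f := hf.rapid []

lemma partialDeriv (hf : IsSchwartzFun f) (i : Fin d) : IsSchwartzFun (partialDeriv i f) :=
  ⟨hf.smooth.partialDeriv i, fun l => by simpa using hf.rapid (l ++ [i])⟩

lemma differentiable (hf : IsSchwartzFun f) : Differentiable ℝ f :=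
  hf.smooth.differentiable (by simp)

lemma integrable_norm_fderiv_sq (hf : IsSchwartzFun f) :
    Integrable fun x => ‖fderiv ℝ f x‖ ^ 2 := by
  have h : IsRapidlyDecaying fun x => (∑ i, |_root_.partialDeriv i f x|) ^ 2 :=
    (IsRapidlyDecaying.finset_sum _ fun i _ => (hf.partialDeriv i).isRapidlyDecaying.abs).sq
  refine h.integrable.mono' (((hf.smooth.continuous_fderiv (by simp)).norm.pow 2
    ).aestronglyMeasurable) (ae_of_all _ fun x => ?_)
  rw [Real.norm_of_nonneg (by positivity)]
  exact pow_le_pow_left₀ (norm_nonneg _) (norm_fderiv_le_sum_abs_partialDeriv x) 2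

end IsSchwartzFun

/-- Smooth bounded weights on `ℝ^d` whose first and second derivatives are bounded by `b`. -/
structure IsWeight {d : ℕ} (a : EuclideanSpace ℝ (Fin d) → ℝ) (M b : ℝ) : Prop where
  smooth : ContDiff ℝ (⊤ : ℕ∞) a
  abs_le : ∀ x, |a x| ≤ M
  abs_deriv_le : ∀ k x, |partialDeriv k a x| ≤ b
  abs_deriv_deriv_le : ∀ i k x, |partialDeriv i (partialDeriv k a) x| ≤ b

section Flux

variable {d : ℕ} {f a F G : EuclideanSpace ℝ (Fin d) → ℝ} {M b : ℝ}

lemma integral_mul_partialDeriv (i : Fin d) (hF : Differentiable ℝ F) (hG : Differentiable ℝ G)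
    (h₁ : IsRapidlyDecaying fun x => partialDeriv i F x * G x)
    (h₂ : IsRapidlyDecaying fun x => F x * partialDeriv i G x)
    (h₃ : IsRapidlyDecaying fun x => F x * G x) :
    ∫ x, F x * partialDeriv i G x = -∫ x, partialDeriv i F x * G x :=
  integral_mul_fderiv_eq_neg_fderiv_mul_of_integrable h₁.integrable h₂.integrable h₃.integrable
    (fun x _ => hF x) (fun x _ => hG x)

lemma integral_mul_weight_mul_third_deriv (hf : IsSchwartzFun f) (ha : IsWeight a M b)
    (i k : Fin d) :
    ∫ x, f x * a x * partialDeriv k (partialDeriv i (partialDeriv i f)) x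
      = ∫ x, ((partialDeriv k f x * partialDeriv i a x + partialDeriv i f x * partialDeriv k a x
          + f x * partialDeriv i (partialDeriv k a) x) * partialDeriv i f x
        - (1 / 2) * (partialDeriv i f x * partialDeriv i f x * partialDeriv k a x)) := by
  have hfi := hf.partialDeriv i
  have hfk := hf.partialDeriv k
  have hfii := hfi.partialDeriv i
  have hfki := hfk.partialDeriv i
  have hfiik := hfii.partialDeriv k
  have da := ha.smooth.differentiable (by simp)
  have ca := ha.smooth.continuous
  have sk := ha.smooth.partialDeriv k
  have dk := sk.differentiable (by simp)
  have ck := sk.continuous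
  have ci := (ha.smooth.partialDeriv i).continuous
  have cik := (sk.partialDeriv i).continuous
  have dfa : partialDeriv k (fun x => f x * a x)
      = fun x => partialDeriv k f x * a x + f x * partialDeriv k a x :=
    partialDeriv_mul k hf.differentiable da
  have rfa := hf.isRapidlyDecaying.mul_bounded ca ha.abs_le
  have rfka := hfk.isRapidlyDecaying.mul_bounded ca ha.abs_le
  have rfak := hf.isRapidlyDecaying.mul_bounded ck (ha.abs_deriv_le k)
  have s0 := integral_mul_partialDeriv k (F := fun x => f x * a x)
    (G := partialDeriv i (partialDeriv i f)) (hf.differentiable.mul da) hfii.differentiable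
    (by rw [dfa]; exact (rfka.add rfak).mul hfii.isRapidlyDecaying)
    (rfa.mul hfiik.isRapidlyDecaying) (rfa.mul hfii.isRapidlyDecaying)
  rw [dfa] at s0
  have dF : partialDeriv i (fun x => partialDeriv k f x * a x + f x * partialDeriv k a x)
      = fun x => (partialDeriv i (partialDeriv k f) x * a x + partialDeriv k f x * partialDeriv i a x)
        + (partialDeriv i f x * partialDeriv k a x
          + f x * partialDeriv i (partialDeriv k a) x) := by
    rw [partialDeriv_add i (hfk.differentiable.fun_mul da) (hf.differentiable.fun_mul dk),
      partialDeriv_mul i hfk.differentiable da, partialDeriv_mul i hf.differentiable dk]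
  have r1 := hfki.isRapidlyDecaying.mul_bounded ca ha.abs_le
  have r2 := hfk.isRapidlyDecaying.mul_bounded ci (ha.abs_deriv_le i)
  have r3 := hfi.isRapidlyDecaying.mul_bounded ck (ha.abs_deriv_le k)
  have r4 := hf.isRapidlyDecaying.mul_bounded cik (ha.abs_deriv_deriv_le i k)
  have s1 := integral_mul_partialDeriv i
    (F := fun x => partialDeriv k f x * a x + f x * partialDeriv k a x)
    (G := partialDeriv i f) ((hfk.differentiable.mul da).add (hf.differentiable.mul dk))
    hfi.differentiable
    (by rw [dF]; exact ((r1.add r2).add (r3.add r4)).mul hfi.isRapidlyDecaying)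
    ((rfka.add rfak).mul hfii.isRapidlyDecaying) ((rfka.add rfak).mul hfi.isRapidlyDecaying)
  rw [dF] at s1
  have dw : partialDeriv k (fun x => partialDeriv i f x * partialDeriv i f x)
      = fun x => partialDeriv i (partialDeriv k f) x * partialDeriv i f x
        + partialDeriv i f x * partialDeriv i (partialDeriv k f) x := by
    rw [partialDeriv_mul k hfi.differentiable hfi.differentiable, partialDeriv_comm k i hf.smooth]
  have rw1 := hfki.isRapidlyDecaying.mul hfi.isRapidlyDecaying
  have rw2 := hfi.isRapidlyDecaying.mul hfki.isRapidlyDecaying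
  have rww := hfi.isRapidlyDecaying.mul hfi.isRapidlyDecaying
  have s2 := integral_mul_partialDeriv k (F := a)
    (G := fun x => partialDeriv i f x * partialDeriv i f x) da
    (hfi.differentiable.mul hfi.differentiable)
    (rww.bounded_mul ck (ha.abs_deriv_le k))
    (by rw [dw]; exact (rw1.add rw2).bounded_mul ca ha.abs_le)
    (rww.bounded_mul ca ha.abs_le)
  rw [dw] at s2
  have rest := (((r2.add r3).add r4).mul hfi.isRapidlyDecaying).integrable (μ := volume)
  rw [s0, s1, neg_neg, integral_sub rest
    ((rww.mul_bounded ck (ha.abs_deriv_le k)).const_mul _).integrable, integral_const_mul]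
  have e : ∫ x, partialDeriv i f x * partialDeriv i f x * partialDeriv k a x
      = -∫ x, a x * (partialDeriv i (partialDeriv k f) x * partialDeriv i f x
        + partialDeriv i f x * partialDeriv i (partialDeriv k f) x) := by
    rw [s2, neg_neg]
    simp only [mul_comm]
  rw [e, mul_neg, sub_neg_eq_add, ← integral_const_mul, ← integral_add rest
    (((rw1.add rw2).bounded_mul ca ha.abs_le).const_mul _).integrable]
  congr 1
  ext x
  ring

lemma integral_sq_mul_partialDeriv_mul_weight (hf : IsSchwartzFun f) (ha : IsWeight a M b)
    (k : Fin d) :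
    ∫ x, f x * a x * (f x * partialDeriv k f x)
      = -∫ x, (1 / 3) * (partialDeriv k a x * (f x * f x * f x)) := by
  have da := ha.smooth.differentiable (by simp)
  have ca := ha.smooth.continuous
  have ck := (ha.smooth.partialDeriv k).continuous
  have r := hf.isRapidlyDecaying
  have rk := (hf.partialDeriv k).isRapidlyDecaying
  have d2 : Differentiable ℝ fun x => f x * f x := hf.differentiable.mul hf.differentiable
  have e : partialDeriv k (fun x => f x * f x * f x)
      = fun x => 3 * (f x * f x * partialDeriv k f x) := by
    rw [partialDeriv_mul k d2 hf.differentiable,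
      partialDeriv_mul k hf.differentiable hf.differentiable]
    ext x
    ring
  have s := integral_mul_partialDeriv k (F := a) (G := fun x => f x * f x * f x) da
    (d2.mul hf.differentiable) (((r.mul r).mul r).bounded_mul ck (ha.abs_deriv_le k))
    (by rw [e]; exact (((r.mul r).mul rk).const_mul 3).bounded_mul ca ha.abs_le)
    (((r.mul r).mul r).bounded_mul ca ha.abs_le)
  rw [integral_const_mul, ← mul_neg, ← s, e, ← integral_const_mul]
  congr 1
  ext x
  ring

/-- The flux of the weighted mass is controlled by the derivatives of the weight. -/
lemma abs_integral_flux_le (hf : IsSchwartzFun f) (ha : IsWeight a M b) (k : Fin d) :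
    |∫ x, f x * a x * (partialDeriv k (fun y => ∑ i, partialDeriv i (partialDeriv i f) y) x
        + f x * partialDeriv k f x)|
      ≤ b * (d * ((∫ x, f x ^ 2) + 3 * ∫ x, ‖fderiv ℝ f x‖ ^ 2) + ∫ x, |f x| ^ 3) := by
  have hb : 0 ≤ b := (abs_nonneg _).trans (ha.abs_deriv_le k 0)
  have r := hf.isRapidlyDecaying
  have rk := (hf.partialDeriv k).isRapidlyDecaying
  have rfa := r.mul_bounded ha.smooth.continuous ha.abs_le
  have rsum (i : Fin d) := rfa.mul
    (((hf.partialDeriv i).partialDeriv i).partialDeriv k).isRapidlyDecaying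
  have i2 : Integrable fun x => f x ^ 2 := r.sq.integrable
  have i3 : Integrable fun x => |f x| ^ 3 := by
    simpa only [pow_succ, pow_zero, one_mul] using ((r.abs.mul r.abs).mul r.abs).integrable
  have ig := hf.integrable_norm_fderiv_sq
  have hdisp (i : Fin d) : |∫ x, f x * a x *
      partialDeriv k (partialDeriv i (partialDeriv i f)) x|
        ≤ b * ((∫ x, f x ^ 2) + 3 * ∫ x, ‖fderiv ℝ f x‖ ^ 2) := by
    rw [integral_mul_weight_mul_third_deriv hf ha, ← integral_const_mul, ← integral_add i2
      (ig.const_mul 3), ← integral_const_mul, ← Real.norm_eq_abs]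
    refine norm_integral_le_of_norm_le ((i2.add (ig.const_mul 3)).const_mul b)
      (ae_of_all _ fun x => ?_)
    have e1 := ha.abs_deriv_le i x
    have e2 := ha.abs_deriv_le k x
    have e3 := ha.abs_deriv_deriv_le i k x
    have g1 := abs_partialDeriv_le (f := f) i x
    have g2 := abs_partialDeriv_le (f := f) k x
    set A := partialDeriv i a x
    set B := partialDeriv k a x
    set C := partialDeriv i (partialDeriv k a) x
    set w := partialDeriv i f x
    set v := partialDeriv k f x
    set D := ‖fderiv ℝ f x‖
    have hD : 0 ≤ D := norm_nonneg _
    rw [Real.norm_eq_abs]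
    have t1 : |v * A * w| ≤ b * D ^ 2 := by
      rw [abs_mul, abs_mul]
      calc |v| * |A| * |w| ≤ D * b * D := by gcongr
        _ = b * D ^ 2 := by ring
    have t2 : |w * B * w| ≤ b * D ^ 2 := by
      rw [abs_mul, abs_mul]
      calc |w| * |B| * |w| ≤ D * b * D := by gcongr
        _ = b * D ^ 2 := by ring
    have t3 : |f x * C * w| ≤ b * (|f x| * D) := by
      rw [abs_mul, abs_mul]
      calc |f x| * |C| * |w| ≤ |f x| * b * D := by gcongr
        _ = b * (|f x| * D) := by ring
    have t4 : b * (|f x| * D) ≤ b * ((1 / 2) * (f x ^ 2 + D ^ 2)) := by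
      refine mul_le_mul_of_nonneg_left ?_ hb
      nlinarith [sq_nonneg (|f x| - D), sq_abs (f x)]
    have t5 : 0 ≤ b * f x ^ 2 := by positivity
    rw [abs_le] at t1 t2 t3 ⊢
    constructor <;> nlinarith
  have hcub : |∫ x, f x * a x * (f x * partialDeriv k f x)| ≤ b * ∫ x, |f x| ^ 3 := by
    rw [integral_sq_mul_partialDeriv_mul_weight hf ha, abs_neg, ← integral_const_mul,
      ← Real.norm_eq_abs]
    refine norm_integral_le_of_norm_le (i3.const_mul b) (ae_of_all _ fun x => ?_)
    rw [Real.norm_eq_abs, abs_mul, abs_mul, abs_mul, abs_mul]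
    have h3 : 0 ≤ |f x| ^ 3 := by positivity
    have := mul_le_mul_of_nonneg_right (ha.abs_deriv_le k x) h3
    have h4 := mul_nonneg (abs_nonneg (partialDeriv k a x)) h3
    rw [abs_of_pos (by norm_num : (0 : ℝ) < 1 / 3)]
    calc 1 / 3 * (|partialDeriv k a x| * (|f x| * |f x| * |f x|))
        = 1 / 3 * (|partialDeriv k a x| * |f x| ^ 3) := by ring
      _ ≤ b * |f x| ^ 3 := by linarith
  have split : ∫ x, f x * a x *
      (partialDeriv k (fun y => ∑ i, partialDeriv i (partialDeriv i f) y) x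
        + f x * partialDeriv k f x)
      = (∑ i, ∫ x, f x * a x * partialDeriv k (partialDeriv i (partialDeriv i f)) x)
        + ∫ x, f x * a x * (f x * partialDeriv k f x) := by
    rw [← integral_finsetSum _ fun i _ => (rsum i).integrable,
      ← integral_add (integrable_finsetSum _ fun i _ => (rsum i).integrable)
        (rfa.mul (r.mul rk)).integrable]
    congr 1
    ext x
    rw [partialDeriv_sum k _ fun i _ => ((hf.partialDeriv i).partialDeriv i).differentiable,
      mul_add, Finset.mul_sum]
  rw [split]
  calc _ ≤ (∑ i, |∫ x, f x * a x * partialDeriv k (partialDeriv i (partialDeriv i f)) x|)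
        + |∫ x, f x * a x * (f x * partialDeriv k f x)| :=
        (abs_add_le _ _).trans (add_le_add_left (Finset.abs_sum_le_sum_abs _ _) _)
    _ ≤ (∑ _i : Fin d, b * ((∫ x, f x ^ 2) + 3 * ∫ x, ‖fderiv ℝ f x‖ ^ 2))
        + b * ∫ x, |f x| ^ 3 := add_le_add (Finset.sum_le_sum fun i _ => hdisp i) hcub
    _ = _ := by simp; ring

end Flux

section Sobolev

open scoped ENNReal

/-- Cutoffs equal to one on large balls with uniformly bounded derivative. -/
lemma exists_cutoff (d : ℕ) :
    ∃ M : ℝ, 0 ≤ M ∧ ∀ n : ℕ, 1 ≤ n → ∃ η : EuclideanSpace ℝ (Fin d) → ℝ,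
      ContDiff ℝ (⊤ : ℕ∞) η ∧ HasCompactSupport η ∧ (∀ x, |η x| ≤ 1) ∧
      (∀ x, ‖fderiv ℝ η x‖ ≤ M) ∧ ∀ x ∈ Metric.ball 0 (n : ℝ), η x = 1 := by
  let χ : ContDiffBump (0 : EuclideanSpace ℝ (Fin d)) := ⟨1, 2, by norm_num, by norm_num⟩
  have χs : ContDiff ℝ (⊤ : ℕ∞) χ := χ.contDiff
  obtain ⟨M, hM⟩ : ∃ M, ∀ x, ‖fderiv ℝ χ x‖ ≤ M :=
    (χ.hasCompactSupport.fderiv ℝ).exists_bound_of_continuous (χs.continuous_fderiv (by simp))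
  refine ⟨M, (norm_nonneg _).trans (hM 0), fun n hn => ?_⟩
  have hn1 : (1 : ℝ) ≤ n := by exact_mod_cast hn
  have hn0 : (0 : ℝ) < n := by linarith
  refine ⟨fun x => χ ((n : ℝ)⁻¹ • x), χs.comp (contDiff_const_smul _),
    χ.hasCompactSupport.comp_smul (inv_ne_zero hn0.ne'), fun x => ?_, fun x => ?_, fun x hx => ?_⟩
  · rw [abs_of_nonneg χ.nonneg]; exact χ.le_one
  · have e : fderiv ℝ (fun x => χ ((n : ℝ)⁻¹ • x)) x
        = (n : ℝ)⁻¹ • fderiv ℝ χ ((n : ℝ)⁻¹ • x) := fderiv_comp_smul _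
    rw [e, norm_smul, norm_inv, Real.norm_natCast]
    calc (n : ℝ)⁻¹ * ‖fderiv ℝ χ ((n : ℝ)⁻¹ • x)‖ ≤ 1 * M := by
          gcongr
          · exact inv_le_one_of_one_le₀ hn1
          · exact hM _
      _ = M := one_mul M
  · refine χ.one_of_mem_closedBall ?_
    rw [mem_closedBall_zero_iff, norm_smul, norm_inv, Real.norm_natCast]
    rw [mem_ball_zero_iff] at hx
    change (n : ℝ)⁻¹ * ‖x‖ ≤ 1
    rw [inv_mul_le_iff₀ hn0]
    linarith

lemma norm_fderiv_mul_sq_le {E : Type*} [NormedAddCommGroup E] [NormedSpace ℝ E] {η f : E → ℝ}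
    {M : ℝ} {x : E} (hη : DifferentiableAt ℝ η x) (hf : DifferentiableAt ℝ f x)
    (h₁ : |η x| ≤ 1) (hM : ‖fderiv ℝ η x‖ ≤ M) :
    ‖fderiv ℝ (fun y => η y * f y ^ 2) x‖ ≤ (M + 1) * f x ^ 2 + ‖fderiv ℝ f x‖ ^ 2 := by
  have e1 : fderiv ℝ (fun y => η y * f y ^ 2) x
      = η x • ((2 * f x) • fderiv ℝ f x) + f x ^ 2 • fderiv ℝ η x := by
    rw [fderiv_fun_mul hη (hf.fun_pow 2), fderiv_fun_pow 2 hf]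
    simp
  rw [e1]
  refine (norm_add_le _ _).trans ?_
  rw [norm_smul, norm_smul, norm_smul, Real.norm_eq_abs, Real.norm_eq_abs, Real.norm_eq_abs,
    abs_of_nonneg (sq_nonneg (f x)), abs_mul, abs_two]
  have b4 := mul_le_mul_of_nonneg_right h₁
    (by positivity : 0 ≤ 2 * |f x| * ‖fderiv ℝ f x‖)
  have b5 := mul_le_mul_of_nonneg_left hM (sq_nonneg (f x))
  nlinarith [sq_nonneg (|f x| - ‖fderiv ℝ f x‖), sq_abs (f x)]

/-- Ladyzhenskaya-type consequence of the Gagliardo–Nirenberg–Sobolev inequality, for functions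
without compact support. -/
lemma exists_lintegral_sq_rpow_le {d : ℕ} {p : ℝ} (hp : Real.HolderConjugate d p) (A : ℝ) :
    ∃ Q : ℝ≥0∞, Q ≠ ∞ ∧ ∀ f : EuclideanSpace ℝ (Fin d) → ℝ, IsSchwartzFun f →
      ∫ x, f x ^ 2 ≤ A → ∫ x, ‖fderiv ℝ f x‖ ^ 2 ≤ A → ∫⁻ x, ‖f x ^ 2‖ₑ ^ p ≤ Q := by
  obtain ⟨M, hM0, hcut⟩ := exists_cutoff d
  have hp0 : 0 ≤ p := hp.symm.nonneg
  obtain ⟨c, hc⟩ : ∃ c : NNReal, ∀ g : EuclideanSpace ℝ (Fin d) → ℝ, ContDiff ℝ 1 g →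
      HasCompactSupport g → ∫⁻ x, ‖g x‖ₑ ^ p ≤ c * (∫⁻ x, ‖fderiv ℝ g x‖ₑ) ^ p :=
    ⟨_, fun g h₁ h₂ => lintegral_pow_le_pow_lintegral_fderiv volume h₁ h₂ (by simpa using hp)⟩
  refine ⟨c * (ENNReal.ofReal ((M + 2) * A)) ^ p,
    ENNReal.mul_ne_top ENNReal.coe_ne_top (ENNReal.rpow_ne_top_of_nonneg hp0 ENNReal.ofReal_ne_top),
    fun f hf h₁ h₂ => ?_⟩
  have hm : Measurable fun x => ‖f x ^ 2‖ₑ ^ p := by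
    have := hf.smooth.continuous.measurable
    fun_prop
  have hcover : AECover (volume : Measure (EuclideanSpace ℝ (Fin d))) atTop
      fun n : ℕ => Metric.ball 0 (n : ℝ) := aecover_ball tendsto_natCast_atTop_atTop
  have ht : Tendsto (fun n : ℕ => ∫⁻ x in Metric.ball 0 (n : ℝ), ‖f x ^ 2‖ₑ ^ p) atTop
      (nhds (∫⁻ x, ‖f x ^ 2‖ₑ ^ p)) :=
    hcover.lintegral_tendsto_of_countably_generated hm.aemeasurable
  refine le_of_tendsto ht ((eventually_ge_atTop 1).mono fun n hn => ?_)
  obtain ⟨η, ηs, ηc, η1, ηM, ηball⟩ := hcut n hn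
  have gs : ContDiff ℝ 1 fun x => η x * f x ^ 2 := (ηs.mul (hf.smooth.pow 2)).of_le (by simp)
  have gc : HasCompactSupport fun x => η x * f x ^ 2 := ηc.mul_right
  have i2 : Integrable fun x => f x ^ 2 := hf.isRapidlyDecaying.sq.integrable
  have i1 : Integrable fun x => (M + 1) * f x ^ 2 + ‖fderiv ℝ f x‖ ^ 2 :=
    (i2.const_mul _).add hf.integrable_norm_fderiv_sq
  have hle : ∫⁻ x, ‖fderiv ℝ (fun x => η x * f x ^ 2) x‖ₑ ≤ ENNReal.ofReal ((M + 2) * A) := by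
    calc ∫⁻ x, ‖fderiv ℝ (fun x => η x * f x ^ 2) x‖ₑ
        ≤ ∫⁻ x, ENNReal.ofReal ((M + 1) * f x ^ 2 + ‖fderiv ℝ f x‖ ^ 2) :=
          lintegral_mono fun x => by
            rw [← ofReal_norm]
            exact ENNReal.ofReal_le_ofReal (norm_fderiv_mul_sq_le
              (ηs.differentiable (by simp) x) (hf.differentiable x) (η1 x) (ηM x))
      _ = ENNReal.ofReal (∫ x, ((M + 1) * f x ^ 2 + ‖fderiv ℝ f x‖ ^ 2)) :=
          (ofReal_integral_eq_lintegral_ofReal i1 (ae_of_all _ fun x => by positivity)).symm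
      _ ≤ ENNReal.ofReal ((M + 2) * A) := by
          refine ENNReal.ofReal_le_ofReal ?_
          rw [integral_add (i2.const_mul _) hf.integrable_norm_fderiv_sq, integral_const_mul]
          nlinarith
  calc ∫⁻ x in Metric.ball 0 (n : ℝ), ‖f x ^ 2‖ₑ ^ p
      = ∫⁻ x in Metric.ball 0 (n : ℝ), ‖η x * f x ^ 2‖ₑ ^ p :=
        setLIntegral_congr_fun Metric.isOpen_ball.measurableSet fun x hx => by
          simp only [ηball x hx, one_mul]
    _ ≤ ∫⁻ x, ‖η x * f x ^ 2‖ₑ ^ p := setLIntegral_le_lintegral _ _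
    _ ≤ c * (∫⁻ x, ‖fderiv ℝ (fun x => η x * f x ^ 2) x‖ₑ) ^ p := hc _ gs gc
    _ ≤ c * (ENNReal.ofReal ((M + 2) * A)) ^ p := mul_le_mul_right (ENNReal.rpow_le_rpow hle hp0) _

lemma exists_integral_abs_cube_le {d : ℕ} (hd : d = 2 ∨ d = 3) (A : ℝ) :
    ∃ B : ℝ, ∀ f : EuclideanSpace ℝ (Fin d) → ℝ, IsSchwartzFun f →
      ∫ x, f x ^ 2 ≤ A → ∫ x, ‖fderiv ℝ f x‖ ^ 2 ≤ A → ∫ x, |f x| ^ 3 ≤ B := by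
  obtain ⟨p, hp, hs⟩ : ∃ p : ℝ, Real.HolderConjugate d p ∧
      ∀ s : ℝ, 0 ≤ s → s ^ 3 ≤ s ^ 2 + (s ^ 2) ^ p := by
    rcases hd with rfl | rfl
    · refine ⟨2, ?_, fun s hs => ?_⟩
      · rw [Real.holderConjugate_iff]; norm_num
      · rw [Real.rpow_two]; nlinarith [sq_nonneg (s * (s - 1)), mul_nonneg hs hs]
    · refine ⟨3 / 2, ?_, fun s hs => ?_⟩
      · rw [Real.holderConjugate_iff]; norm_num
      · rw [← Real.rpow_natCast s 2, ← Real.rpow_mul hs]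
        norm_num
        positivity
  obtain ⟨Q, hQ, h⟩ := exists_lintegral_sq_rpow_le hp A
  have hp0 : 0 ≤ p := hp.symm.nonneg
  refine ⟨(ENNReal.ofReal A + Q).toReal, fun f hf h₁ h₂ => ?_⟩
  rw [integral_eq_lintegral_of_nonneg_ae (ae_of_all _ fun x => by positivity)
    (Continuous.aestronglyMeasurable (by have := hf.smooth.continuous; fun_prop))]
  refine ENNReal.toReal_mono (ENNReal.add_ne_top.2 ⟨ENNReal.ofReal_ne_top, hQ⟩) ?_
  calc ∫⁻ x, ENNReal.ofReal (|f x| ^ 3)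
      ≤ ∫⁻ x, (ENNReal.ofReal (f x ^ 2) + ‖f x ^ 2‖ₑ ^ p) := by
        refine lintegral_mono fun x => ?_
        rw [Real.enorm_of_nonneg (sq_nonneg _), ENNReal.ofReal_rpow_of_nonneg (sq_nonneg _) hp0,
          ← ENNReal.ofReal_add (sq_nonneg _) (by positivity)]
        exact ENNReal.ofReal_le_ofReal (by simpa using hs |f x| (abs_nonneg _))
    _ = ENNReal.ofReal (∫ x, f x ^ 2) + ∫⁻ x, ‖f x ^ 2‖ₑ ^ p := by
        rw [lintegral_add_left (f := fun x => ENNReal.ofReal (f x ^ 2))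
          (hf.smooth.continuous.pow 2).measurable.ennreal_ofReal,
          ofReal_integral_eq_lintegral_ofReal hf.isRapidlyDecaying.sq.integrable
            (ae_of_all _ fun x => sq_nonneg _)]
    _ ≤ _ := add_le_add (ENNReal.ofReal_le_ofReal h₁) (h f hf h₁ h₂)

end Sobolev

/-- Bounded smooth one-dimensional profiles, with their first two derivatives. -/
structure IsProfile (ψ ψ₁ ψ₂ : ℝ → ℝ) (M : ℝ) : Prop where
  smooth : ContDiff ℝ (⊤ : ℕ∞) ψ
  hasDerivAt : ∀ y, HasDerivAt ψ (ψ₁ y) y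
  hasDerivAt_deriv : ∀ y, HasDerivAt ψ₁ (ψ₂ y) y
  abs_le : ∀ y, |ψ y| ≤ M
  abs_deriv_le : ∀ y, |ψ₁ y| ≤ M
  abs_deriv_deriv_le : ∀ y, |ψ₂ y| ≤ M
  abs_mul_deriv_le : ∀ y, |y * ψ₁ y| ≤ M

section Profile

variable {d : ℕ} {ψ ψ₁ ψ₂ : ℝ → ℝ} {M θ : ℝ}

lemma partialDeriv_comp_coord_div (hψ : ∀ y, HasDerivAt ψ (ψ₁ y) y) (θ : ℝ) (j k : Fin d) :
    partialDeriv k (fun x => ψ (x j / θ))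
      = fun x => ψ₁ (x j / θ) * (EuclideanSpace.single k (1 : ℝ) j / θ) := by
  ext x
  have h : HasFDerivAt (fun x : EuclideanSpace ℝ (Fin d) => x j / θ)
      (θ⁻¹ • EuclideanSpace.proj j : EuclideanSpace ℝ (Fin d) →L[ℝ] ℝ) x := by
    have := ((EuclideanSpace.proj j : EuclideanSpace ℝ (Fin d) →L[ℝ] ℝ).hasFDerivAt
      (x := x)).const_smul θ⁻¹
    refine this.congr_of_eventuallyEq (Eventually.of_forall fun y => ?_)
    simp [div_eq_inv_mul]
  have h2 := (hψ (x j / θ)).comp_hasFDerivAt x h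
  change fderiv ℝ (ψ ∘ fun x : EuclideanSpace ℝ (Fin d) => x j / θ) x _ = _
  rw [h2.fderiv]
  simp [div_eq_inv_mul]

lemma IsProfile.isWeight (h : IsProfile ψ ψ₁ ψ₂ M) (hθ : 1 ≤ θ) (j : Fin d) :
    IsWeight (fun x : EuclideanSpace ℝ (Fin d) => ψ (x j / θ)) M (M / θ) := by
  have hθ0 : 0 < θ := by linarith
  have hM : 0 ≤ M := (abs_nonneg _).trans (h.abs_le 0)
  have hc (k : Fin d) : |EuclideanSpace.single k (1 : ℝ) j / θ| ≤ 1 / θ := by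
    rw [abs_div, abs_of_pos hθ0]
    gcongr
    by_cases hjk : j = k <;> simp [hjk]
  have e1 (k : Fin d) := partialDeriv_comp_coord_div (d := d) h.hasDerivAt θ j k
  refine ⟨?_, fun x => h.abs_le _, fun k x => ?_, fun i k x => ?_⟩
  · exact h.smooth.comp (by fun_prop)
  · rw [e1, abs_mul, div_eq_mul_one_div M]
    exact mul_le_mul (h.abs_deriv_le _) (hc k) (abs_nonneg _) hM
  · rw [e1]
    have e2 := partialDeriv_comp_coord_div (d := d)
      (fun y => (h.hasDerivAt_deriv y).mul_const (EuclideanSpace.single k (1 : ℝ) j / θ)) θ j i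
    rw [e2, abs_mul, abs_mul]
    have h1 : (1 / θ) ≤ 1 := by rw [div_le_one hθ0]; exact hθ
    calc |ψ₂ (x j / θ)| * |EuclideanSpace.single k (1 : ℝ) j / θ|
          * |EuclideanSpace.single i (1 : ℝ) j / θ| ≤ M * 1 * (1 / θ) := by
          gcongr
          · exact h.abs_deriv_deriv_le _
          · exact (hc k).trans h1
          · exact hc i
      _ = M / θ := by ring

end Profile

section Admissible

variable {d : ℕ} {j₀ : Fin d} {u : ℝ → EuclideanSpace ℝ (Fin d) → ℝ}

lemma contDiff_uncurry_Dd
    (hu : ContDiff ℝ (⊤ : ℕ∞) fun q : ℝ × EuclideanSpace ℝ (Fin d) => u q.1 q.2)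
    (l : List (Option (Fin d))) :
    ContDiff ℝ (⊤ : ℕ∞) fun q : ℝ × EuclideanSpace ℝ (Fin d) => Dd u l q.1 q.2 := by
  induction l with
  | nil => exact hu
  | cons o l ih =>
    have hd := ih.differentiable (by simp)
    have hs := ih.fderiv_right (m := (⊤ : ℕ∞)) (by simp)
    rcases o with _ | j
    · have e : (fun q : ℝ × EuclideanSpace ℝ (Fin d) => Dd u (none :: l) q.1 q.2)
          = fun q => fderiv ℝ (fun q : ℝ × EuclideanSpace ℝ (Fin d) => Dd u l q.1 q.2) q (1, 0) := by
        ext ⟨t, x⟩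
        have h := (hd (t, x)).hasFDerivAt.comp_hasDerivAt t
          ((hasDerivAt_id t).prodMk (hasDerivAt_const t x))
        exact h.deriv
      rw [e]
      exact hs.clm_apply contDiff_const
    · have e : (fun q : ℝ × EuclideanSpace ℝ (Fin d) => Dd u (some j :: l) q.1 q.2)
          = fun q => fderiv ℝ (fun q : ℝ × EuclideanSpace ℝ (Fin d) => Dd u l q.1 q.2) q
            (0, EuclideanSpace.single j 1) := by
        ext ⟨t, x⟩
        have h := (hd (t, x)).hasFDerivAt.comp x
          ((hasFDerivAt_const t x).prodMk (hasFDerivAt_id x))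
        change fderiv ℝ ((fun q : ℝ × EuclideanSpace ℝ (Fin d) => Dd u l q.1 q.2)
          ∘ Prod.mk t) x _ = _
        rw [h.fderiv]
        simp
      rw [e]
      exact hs.clm_apply contDiff_const

lemma foldr_partialDeriv_Dd (l : List (Fin d)) (l' : List (Option (Fin d))) (t : ℝ) :
    l.foldr partialDeriv (Dd u l' t) = Dd u (l.map some ++ l') t := by
  induction l with
  | nil => rfl
  | cons i l ih => rw [List.foldr_cons, ih]; rfl

lemma IsAdmissibleZKd.isSchwartzFun (hu : IsAdmissibleZKd d j₀ u) (l : List (Option (Fin d)))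
    {t : ℝ} (ht : 2 ≤ t) : IsSchwartzFun (Dd u l t) := by
  have hs (l) : ContDiff ℝ (⊤ : ℕ∞) (Dd u l t) :=
    (contDiff_uncurry_Dd hu.smooth l).comp (contDiff_const.prodMk contDiff_id)
  refine ⟨hs l, fun m => ?_⟩
  rw [foldr_partialDeriv_Dd]
  refine ⟨(hs _).continuous, fun N => ?_⟩
  obtain ⟨C, hC⟩ := hu.decay (m.map some ++ l) N t t ht
  exact ⟨C, fun x => hC t x ⟨le_rfl, le_rfl⟩⟩

/-- Derivative of a weighted mass whose weight is dilated at logarithmic rate `r`. -/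
lemma IsAdmissibleZKd.hasDerivAt_integral_sq_mul (hu : IsAdmissibleZKd d j₀ u)
    {ψ ψ₁ ψ₂ : ℝ → ℝ} {M : ℝ} (hψ : IsProfile ψ ψ₁ ψ₂ M) {θ r : ℝ → ℝ}
    (hθ : ∀ s, 2 < s → HasDerivAt θ (r s * θ s) s) (hθ0 : ∀ s, 2 < s → 0 < θ s)
    (hr : ContinuousOn r (Set.Ici 2)) (j : Fin d) {t : ℝ} (ht : 2 < t) :
    HasDerivAt (fun s => ∫ x, u s x ^ 2 * ψ (x j / θ s))
      (2 * (∫ x, u t x * ψ (x j / θ t) * ptd u t x)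
        - r t * ∫ x, u t x ^ 2 * (x j / θ t * ψ₁ (x j / θ t))) t := by
  have hM : 0 ≤ M := (abs_nonneg _).trans (hψ.abs_le 0)
  obtain ⟨R, hR⟩ := isCompact_Icc.exists_bound_of_continuousOn
    (hr.mono (Set.Icc_subset_Ici_self : Set.Icc 2 (t + 1) ⊆ Set.Ici 2))
  obtain ⟨C, hC⟩ := hu.decay [] (d + 1) 2 (t + 1) le_rfl
  obtain ⟨D, hD⟩ := hu.decay [none] 0 2 (t + 1) le_rfl
  obtain ⟨D', hD'⟩ := hu.decay [] 0 2 (t + 1) le_rfl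
  simp only [pow_zero, one_mul, Dd] at hC hD hD'
  have hψc : Continuous ψ := hψ.smooth.continuous
  have hψ₁c : Continuous ψ₁ :=
    continuous_iff_continuousAt.2 fun y => (hψ.hasDerivAt_deriv y).continuousAt
  have hmem : Set.Ioo 2 (t + 1) ∈ nhds t := Ioo_mem_nhds ht (by linarith)
  have su (s : ℝ) (hs : 2 ≤ s) : IsRapidlyDecaying (u s) :=
    (hu.isSchwartzFun [] hs).isRapidlyDecaying
  have sut : IsRapidlyDecaying (ptd u t) := (hu.isSchwartzFun [none] ht.le).isRapidlyDecaying
  have r0 (s : ℝ) (hs : 2 ≤ s) : IsRapidlyDecaying fun x => u s x ^ 2 * ψ (x j / θ s) :=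
    (su s hs).sq.mul_bounded (by fun_prop) fun x => hψ.abs_le _
  have r1 : IsRapidlyDecaying fun x => u t x * ψ (x j / θ t) * ptd u t x :=
    ((su t ht.le).mul_bounded (g := fun x => ψ (x j / θ t)) (by fun_prop)
      fun x => hψ.abs_le _).mul sut
  have r2 : IsRapidlyDecaying fun x => u t x ^ 2 * (x j / θ t * ψ₁ (x j / θ t)) :=
    (su t ht.le).sq.mul_bounded (by fun_prop) fun x => hψ.abs_mul_deriv_le _
  let F' : ℝ → EuclideanSpace ℝ (Fin d) → ℝ := fun s x =>
    2 * (u s x * ψ (x j / θ s) * ptd u s x) - r s * (u s x ^ 2 * (x j / θ s * ψ₁ (x j / θ s)))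
  have key := hasDerivAt_integral_of_dominated_loc_of_deriv_le (μ := volume) (x₀ := t)
    (F := fun s x => u s x ^ 2 * ψ (x j / θ s)) (F' := F')
    (bound := fun x => (2 * (M * D) + R * (D' * M)) * C * (1 + ‖x‖) ^ (-((d + 1 : ℕ) : ℝ)))
    hmem
    (by filter_upwards [hmem] with s hs using (r0 s hs.1.le).continuous.aestronglyMeasurable)
    (r0 t ht.le).integrable
    ((r1.integrable.const_mul 2).sub (r2.integrable.const_mul (r t))).aestronglyMeasurable
    (ae_of_all _ fun x s hs => ?_)
    ((integrable_one_add_norm (by simp)).const_mul _)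
    (ae_of_all _ fun x s hs => ?_)
  · have e : ∫ x, F' t x = 2 * (∫ x, u t x * ψ (x j / θ t) * ptd u t x)
        - r t * ∫ x, u t x ^ 2 * (x j / θ t * ψ₁ (x j / θ t)) := by
      simp only [F']
      rw [integral_sub (r1.integrable.const_mul 2) (r2.integrable.const_mul (r t)),
        integral_const_mul, integral_const_mul]
    rw [← e]
    exact key.2
  · have hsI : s ∈ Set.Icc 2 (t + 1) := ⟨hs.1.le, hs.2.le⟩
    have hx : 0 < 1 + ‖x‖ := by positivity
    have hux : |u s x| ≤ C * (1 + ‖x‖) ^ (-((d + 1 : ℕ) : ℝ)) := by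
      rw [Real.rpow_neg hx.le, Real.rpow_natCast, ← div_eq_mul_inv, le_div_iff₀ (by positivity),
        mul_comm]
      exact hC s x hsI
    have hD0 : 0 ≤ D := (abs_nonneg _).trans (hD s x hsI)
    have hR0 : 0 ≤ R := (norm_nonneg _).trans (hR s hsI)
    have e : F' s x = (2 * (ψ (x j / θ s) * ptd u s x)
        - r s * (u s x * (x j / θ s * ψ₁ (x j / θ s)))) * u s x := by
      simp only [F']; ring
    rw [e, norm_mul, Real.norm_eq_abs (u s x), mul_assoc]
    have hD'0 : 0 ≤ D' := (abs_nonneg _).trans (hD' s x hsI)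
    refine mul_le_mul ?_ hux (abs_nonneg _) (by positivity)
    refine (norm_sub_le _ _).trans ?_
    rw [norm_mul, norm_mul, norm_mul, norm_mul]
    have h2 : ‖(2 : ℝ)‖ = 2 := by norm_num
    rw [h2]
    gcongr
    · exact hψ.abs_le _
    · exact hD s x hsI
    · exact hR s hsI
    · exact hD' s x hsI
    · exact hψ.abs_mul_deriv_le _
  · have hut : HasDerivAt (fun s => u s x) (ptd u s x) s := by
      have : Differentiable ℝ fun s => u s x :=
        (hu.smooth.differentiable (by simp)).comp (differentiable_id.prodMk
          (differentiable_const x))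
      exact (this s).hasDerivAt
    have hθs := (hθ0 s hs.1).ne'
    have hq : HasDerivAt (fun s => x j / θ s) (-(r s * (x j / θ s))) s := by
      refine ((hasDerivAt_const s (x j)).fun_div (hθ s hs.1) hθs).congr_deriv ?_
      field_simp
      ring
    refine ((hut.fun_pow 2).fun_mul ((hψ.hasDerivAt _).comp s hq)).congr_deriv ?_
    simp only [F']
    norm_num
    ring

end Admissible

section Growth

lemma exists_tendsto_of_deriv_nonneg {P P' : ℝ → ℝ} {T B : ℝ}
    (hP : ∀ t, T < t → HasDerivAt P (P' t) t) (h0 : ∀ t, T < t → 0 ≤ P' t)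
    (hB : ∀ t, T < t → P t ≤ B) : ∃ l, Tendsto P atTop (nhds l) := by
  have hmono : MonotoneOn P (Set.Ioi T) := by
    refine monotoneOn_of_deriv_nonneg (convex_Ioi T)
      (fun t ht => (hP t ht).continuousAt.continuousWithinAt)
      (fun t ht => ?_) (fun t ht => ?_)
    all_goals rw [interior_Ioi] at ht
    · exact (hP t ht).differentiableAt.differentiableWithinAt
    · rw [(hP t ht).deriv]; exact h0 t ht
  have hT (t : ℝ) : T < max t (T + 1) := lt_max_of_lt_right (by linarith)
  have hm : Monotone fun t => P (max t (T + 1)) := fun a b hab =>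
    hmono (hT a) (hT b) (max_le_max hab le_rfl)
  refine ⟨_, (tendsto_atTop_ciSup hm ⟨B, ?_⟩).congr' ?_⟩
  · rintro _ ⟨t, rfl⟩
    exact hB _ (hT t)
  · filter_upwards [eventually_ge_atTop (T + 1)] with t ht
    rw [max_eq_left ht]

/-- If `L ≥ 0` grows at most at twice the rate at which it feeds a bounded quantity `K`, up to
errors with a vanishing primitive `H`, and the rate is at least `1 / t`, then `L` vanishes at
infinity. -/
lemma tendsto_zero_of_bounded_feed {K K' L L' H h r : ℝ → ℝ} {T B : ℝ} (hT : 1 ≤ T)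
    (hK : ∀ t, T < t → HasDerivAt K (K' t) t) (hL : ∀ t, T < t → HasDerivAt L (L' t) t)
    (hH : ∀ t, T < t → HasDerivAt H (-h t) t)
    (hK' : ∀ t, T < t → r t * L t - h t ≤ K' t)
    (hL' : ∀ t, T < t → L' t ≤ 2 * (r t * L t) + h t)
    (hr : ∀ t, T < t → 1 / t ≤ r t) (hL0 : ∀ t, T < t → 0 ≤ L t)
    (hKB : ∀ t, T < t → K t ≤ B) (hH0 : ∀ t, T < t → 0 ≤ H t)
    (hHlim : Tendsto H atTop (nhds 0)) : Tendsto L atTop (nhds 0) := by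
  have hrL (t) (ht : T < t) : 0 ≤ r t * L t :=
    mul_nonneg (le_trans (by have : 0 < t := by linarith
                             positivity) (hr t ht)) (hL0 t ht)
  obtain ⟨p, hp⟩ := exists_tendsto_of_deriv_nonneg (P := fun t => K t - H t) (B := B)
    (fun t ht => (hK t ht).fun_sub (hH t ht))
    (fun t ht => by linarith [hK' t ht, hrL t ht]) (fun t ht => by linarith [hKB t ht, hH0 t ht])
  obtain ⟨q, hq⟩ := exists_tendsto_of_deriv_nonneg (P := fun t => 2 * (K t - H t) - L t - H t)
    (B := 2 * B)
    (fun t ht => ((((hK t ht).fun_sub (hH t ht)).const_mul 2).fun_sub (hL t ht)).fun_sub (hH t ht))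
    (fun t ht => by linarith [hK' t ht, hL' t ht])
    (fun t ht => by linarith [hKB t ht, hH0 t ht, hL0 t ht])
  obtain ⟨l, hl⟩ : ∃ l, Tendsto L atTop (nhds l) := by
    refine ⟨_, (((hp.const_mul 2).sub hq).sub hHlim).congr fun t => ?_⟩
    ring
  have hl0 : 0 ≤ l := ge_of_tendsto hl ((eventually_gt_atTop T).mono hL0)
  rcases hl0.eq_or_lt with rfl | hpos
  · exact hl
  exfalso
  obtain ⟨T₁, hT₁⟩ := eventually_atTop.1 (hl.eventually (eventually_ge_nhds (half_lt_self hpos)))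
  have hTT (t) (ht : max T T₁ < t) : T < t := (le_max_left _ _).trans_lt ht
  obtain ⟨m, hm⟩ := exists_tendsto_of_deriv_nonneg (T := max T T₁) (B := B)
    (P := fun t => (K t - H t) - l / 2 * Real.log t)
    (fun t ht => ((hK t (hTT t ht)).fun_sub (hH t (hTT t ht))).fun_sub
      ((Real.hasDerivAt_log (by linarith [hTT t ht])).const_mul (l / 2)))
    (fun t ht => by
      have h0 : 0 < t := by linarith [hTT t ht]
      have h1 := hT₁ t ((le_max_right _ _).trans ht.le)
      have h2 := mul_le_mul (hr t (hTT t ht)) h1 (by linarith)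
        (le_trans (by positivity) (hr t (hTT t ht)))
      rw [one_div, mul_comm] at h2
      linarith [hK' t (hTT t ht)])
    (fun t ht => by
      have h1 := Real.log_nonneg (hT.trans (hTT t ht).le)
      have h2 := mul_nonneg (half_pos hpos).le h1
      linarith [hKB t (hTT t ht), hH0 t (hTT t ht)])
  refine not_tendsto_nhds_of_tendsto_atTop
    (Real.tendsto_log_atTop.const_mul_atTop (half_pos hpos)) (p - m)
    ((hp.sub hm).congr fun t => ?_)
  ring

end Growth

section Profiles

lemma abs_div_one_add_sq_pow_le {a y M : ℝ} (n : ℕ) (h : |a| ≤ M * (1 + y ^ 2) ^ n) :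
    |a / (1 + y ^ 2) ^ n| ≤ M := by
  have : 0 < (1 + y ^ 2) ^ n := by positivity
  rwa [abs_div, abs_of_pos this, div_le_iff₀ this]

lemma isProfile_inv_one_add_sq :
    IsProfile (fun y => 1 / (1 + y ^ 2)) (fun y => -2 * y / (1 + y ^ 2) ^ 2)
      (fun y => (6 * y ^ 2 - 2) / (1 + y ^ 2) ^ 3) 50 := by
  have h0 (y : ℝ) : 1 + y ^ 2 ≠ 0 := by positivity
  have hd (y : ℝ) : HasDerivAt (fun y : ℝ => 1 + y ^ 2) (2 * y) y := by
    simpa using (hasDerivAt_pow 2 y).const_add 1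
  refine ⟨contDiff_const.div (by fun_prop) h0, fun y => ?_, fun y => ?_, fun y => ?_, fun y => ?_,
    fun y => ?_, fun y => ?_⟩
  · refine ((hasDerivAt_const y (1 : ℝ)).fun_div (hd y) (h0 y)).congr_deriv ?_
    ring
  · refine (((hasDerivAt_id y).const_mul (-2)).fun_div ((hd y).fun_pow 2)
      (pow_ne_zero 2 (h0 y))).congr_deriv ?_
    have := h0 y
    simp only [id]
    field_simp
    ring
  · have := abs_div_one_add_sq_pow_le (a := 1) (y := y) (M := 50) 1
      (by rw [abs_one]; nlinarith [sq_nonneg y])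
    simpa using this
  · refine abs_div_one_add_sq_pow_le 2 (abs_le.2 ⟨?_, ?_⟩) <;>
      nlinarith [sq_nonneg (y - 1), sq_nonneg (y + 1), sq_nonneg (y ^ 2), sq_nonneg y]
  · refine abs_div_one_add_sq_pow_le 3 (abs_le.2 ⟨?_, ?_⟩) <;>
      nlinarith [sq_nonneg y, sq_nonneg (y ^ 2), mul_nonneg (sq_nonneg y) (sq_nonneg (y ^ 2))]
  · rw [← mul_div_assoc]
    refine abs_div_one_add_sq_pow_le 2 (abs_le.2 ⟨?_, ?_⟩) <;>
      nlinarith [sq_nonneg y, sq_nonneg (y ^ 2)]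

lemma isProfile_bump :
    IsProfile (fun y => 2 * y ^ 2 / (1 + y ^ 2) ^ 2) (fun y => 4 * y * (1 - y ^ 2) / (1 + y ^ 2) ^ 3)
      (fun y => (4 - 32 * y ^ 2 + 12 * y ^ 4) / (1 + y ^ 2) ^ 4) 50 := by
  have h0 (y : ℝ) : 1 + y ^ 2 ≠ 0 := by positivity
  have hd (y : ℝ) : HasDerivAt (fun y : ℝ => 1 + y ^ 2) (2 * y) y := by
    simpa using (hasDerivAt_pow 2 y).const_add 1
  have hp (y : ℝ) : 0 ≤ y ^ 2 ∧ 0 ≤ y ^ 4 ∧ 0 ≤ y ^ 6 ∧ 0 ≤ y ^ 8 := by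
    refine ⟨?_, ?_, ?_, ?_⟩ <;> positivity
  refine ⟨ContDiff.div (by fun_prop) (by fun_prop) fun y => pow_ne_zero 2 (h0 y), fun y => ?_,
    fun y => ?_, fun y => ?_, fun y => ?_, fun y => ?_, fun y => ?_⟩
  · refine (((hasDerivAt_pow 2 y).const_mul 2).fun_div ((hd y).fun_pow 2)
      (pow_ne_zero 2 (h0 y))).congr_deriv ?_
    have := h0 y
    field_simp
    ring
  · refine ((((hasDerivAt_id y).const_mul 4).fun_mul ((hasDerivAt_pow 2 y).const_sub 1)).fun_div
      ((hd y).fun_pow 3) (pow_ne_zero 3 (h0 y))).congr_deriv ?_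
    have := h0 y
    simp only [id]
    field_simp
    ring
  all_goals obtain ⟨h2, h4, h6, h8⟩ := hp y
  · refine abs_div_one_add_sq_pow_le 2 (abs_le.2 ⟨?_, ?_⟩) <;> nlinarith
  · refine abs_div_one_add_sq_pow_le 3 ?_
    have h1 : |y| ≤ 1 + y ^ 2 := abs_le.2 ⟨by nlinarith, by nlinarith⟩
    have h3 : |1 - y ^ 2| ≤ 1 + y ^ 2 := abs_le.2 ⟨by linarith, by linarith⟩
    rw [abs_mul, abs_mul]
    calc |4| * |y| * |1 - y ^ 2| ≤ 4 * (1 + y ^ 2) * (1 + y ^ 2) := by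
          rw [abs_of_pos (by norm_num : (0 : ℝ) < 4)]; gcongr
      _ ≤ 50 * (1 + y ^ 2) ^ 3 := by ring_nf; linarith
  · refine abs_div_one_add_sq_pow_le 4 (abs_le.2 ⟨?_, ?_⟩) <;> ring_nf <;> linarith
  · rw [← mul_div_assoc]
    refine abs_div_one_add_sq_pow_le 3 (abs_le.2 ⟨?_, ?_⟩) <;> ring_nf <;> linarith

end Profiles

section Scale

/-- The scale `t ^ p * (log t) ^ (1 + ε)` and its logarithmic derivative. -/
lemma hasDerivAt_rpow_mul_log_rpow (p ε : ℝ) {t : ℝ} (ht : 1 < t) :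
    HasDerivAt (fun s => s ^ p * Real.log s ^ (1 + ε))
      ((p / t + (1 + ε) / (t * Real.log t)) * (t ^ p * Real.log t ^ (1 + ε))) t := by
  have ht0 : 0 < t := by linarith
  have hl : 0 < Real.log t := Real.log_pos ht
  refine ((Real.hasDerivAt_rpow_const (p := p) (Or.inl ht0.ne')).fun_mul
    ((Real.hasDerivAt_log ht0.ne').rpow_const (p := 1 + ε) (Or.inl hl.ne'))).congr_deriv ?_
  rw [Real.rpow_sub_one ht0.ne', Real.rpow_sub_one hl.ne']
  field_simp

lemma hasDerivAt_log_rpow_neg (c : ℝ) {ε : ℝ} (hε : 0 < ε) {t : ℝ} (ht : 1 < t) :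
    HasDerivAt (fun s => c / ε * Real.log s ^ (-ε)) (-(c / (t * Real.log t ^ (1 + ε)))) t := by
  have ht0 : 0 < t := by linarith
  have hl : 0 < Real.log t := Real.log_pos ht
  refine (((Real.hasDerivAt_log ht0.ne').rpow_const (p := -ε) (Or.inl hl.ne')).const_mul
    (c / ε)).congr_deriv ?_
  rw [show -ε - 1 = -(1 + ε) by ring, Real.rpow_neg hl.le]
  field_simp

lemma one_lt_log_of_three_lt {t : ℝ} (ht : 3 < t) : 1 < Real.log t := by
  rw [Real.lt_log_iff_exp_lt (by linarith)]
  linarith [Real.exp_one_lt_three]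

lemma mul_log_rpow_le_scale {p : ℝ} (hp : 1 ≤ p) (ε : ℝ) {t : ℝ} (ht : 3 < t) :
    t * Real.log t ^ (1 + ε) ≤ t ^ p * Real.log t ^ (1 + ε) := by
  have hl := one_lt_log_of_three_lt ht
  refine mul_le_mul_of_nonneg_right ?_ (Real.rpow_nonneg (by linarith) _)
  simpa using Real.rpow_le_rpow_of_exponent_le (by linarith : 1 ≤ t) hp

end Scale

/-- The flux part of the derivative of a weighted mass, in terms of the energy bounds. -/
lemma IsAdmissibleZKd.abs_integral_mul_ptd_le {d : ℕ} {j₀ : Fin d}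
    {u : ℝ → EuclideanSpace ℝ (Fin d) → ℝ} (hu : IsAdmissibleZKd d j₀ u)
    {t : ℝ} (ht : 2 ≤ t) {a : EuclideanSpace ℝ (Fin d) → ℝ} {M b A B : ℝ} (ha : IsWeight a M b)
    (h₁ : ∫ x, u t x ^ 2 ≤ A) (h₂ : ∫ x, ‖fderiv ℝ (u t) x‖ ^ 2 ≤ A)
    (h₃ : ∫ x, |u t x| ^ 3 ≤ B) :
    |∫ x, u t x * a x * ptd u t x| ≤ b * (4 * d * A + B) := by
  have hb : 0 ≤ b := (abs_nonneg _).trans (ha.abs_deriv_le j₀ 0)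
  have hS : IsSchwartzFun (u t) := hu.isSchwartzFun [] ht
  have e : ∫ x, u t x * a x * ptd u t x
      = -∫ x, u t x * a x * (partialDeriv j₀
          (fun y => ∑ i, partialDeriv i (partialDeriv i (u t)) y) x
        + u t x * partialDeriv j₀ (u t) x) := by
    rw [← integral_neg]
    congr 1
    ext x
    have h : ptd u t x + partialDeriv j₀
        (fun y => ∑ i, partialDeriv i (partialDeriv i (u t)) y) x
        + u t x * partialDeriv j₀ (u t) x = 0 := hu.eqn t x ht
    linear_combination (u t x * a x) * h
  rw [e, abs_neg]
  refine (abs_integral_flux_le hS ha j₀).trans (mul_le_mul_of_nonneg_left ?_ hb)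
  have hd : (0 : ℝ) ≤ d := Nat.cast_nonneg d
  nlinarith

/-- Strong `L²` decay in far regions for ZK in dimension `d ∈ {2,3}`:
`lim_{t→∞} ∫_{Ω_j(t)} u(t,x)² dx = 0` where
`Ω_j(t) = {x : c₁ t^p (log t)^{1+ε} ≤ |x_j| ≤ c₂ t^p (log t)^{1+ε}}`. -/
theorem zk_far_region_strong_decay
    (d : ℕ) (hd : d = 2 ∨ d = 3)
    (p ε c₁ c₂ : ℝ) (hp : 1 ≤ p) (hε : 0 < ε) (hc₁ : 0 < c₁) (hc₁₂ : c₁ < c₂)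
    (j : Fin d)
    (u : ℝ → EuclideanSpace ℝ (Fin d) → ℝ)
    (hu : IsAdmissibleZKd d ⟨0, by rcases hd with h | h <;> omega⟩ u)
    (hH1 : ∃ C : ℝ, ∀ t : ℝ, 2 ≤ t →
      Real.sqrt (∫ x : EuclideanSpace ℝ (Fin d), (u t x)^2)
        + Real.sqrt (∫ x : EuclideanSpace ℝ (Fin d), ‖fderiv ℝ (fun y => u t y) x‖^2)
          ≤ C) :
    Tendsto
      (fun t : ℝ =>
        ∫ x in {x : EuclideanSpace ℝ (Fin d) |
            c₁ * t ^ p * (Real.log t) ^ (1+ε) ≤ |x j| ∧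
            |x j| ≤ c₂ * t ^ p * (Real.log t) ^ (1+ε)},
          (u t x)^2)
      Filter.atTop (nhds 0) := by
  obtain ⟨C, hC⟩ := hH1
  have hA (t : ℝ) (ht : 2 ≤ t) : ∫ x, u t x ^ 2 ≤ C ^ 2 :=
    Real.sqrt_le_left (x := ∫ x, u t x ^ 2) (y := C)
      (le_trans (by positivity) (hC t ht)) |>.1
      (by linarith [hC t ht, Real.sqrt_nonneg (∫ x, ‖fderiv ℝ (fun y => u t y) x‖ ^ 2)])
  have hA' (t : ℝ) (ht : 2 ≤ t) : ∫ x, ‖fderiv ℝ (u t) x‖ ^ 2 ≤ C ^ 2 :=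
    Real.sqrt_le_left (le_trans (by positivity) (hC t ht)) |>.1
      (by linarith [hC t ht, Real.sqrt_nonneg (∫ x, u t x ^ 2)])
  have hS (t : ℝ) (ht : 2 ≤ t) : IsSchwartzFun (u t) := hu.isSchwartzFun [] ht
  obtain ⟨B, hB⟩ := exists_integral_abs_cube_le hd (C ^ 2)
  have hB' (t : ℝ) (ht : 2 ≤ t) := hB (u t) (hS t ht) (hA t ht) (hA' t ht)
  have hB0 : 0 ≤ B := le_trans (integral_nonneg fun x => by positivity) (hB' 2 le_rfl)
  set θ : ℝ → ℝ := fun s => s ^ p * Real.log s ^ (1 + ε) with hθdef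
  set r : ℝ → ℝ := fun s => p / s + (1 + ε) / (s * Real.log s) with hrdef
  have hθ (s : ℝ) (hs : 2 < s) : HasDerivAt θ (r s * θ s) s :=
    hasDerivAt_rpow_mul_log_rpow p ε (by linarith)
  have hθ0 (s : ℝ) (hs : 2 < s) : 0 < θ s :=
    mul_pos (Real.rpow_pos_of_pos (by linarith) _)
      (Real.rpow_pos_of_pos (Real.log_pos (by linarith)) _)
  have hlog0 (s : ℝ) (hs : 2 ≤ s) : 0 < Real.log s := Real.log_pos (by linarith)
  have hrc : ContinuousOn r (Set.Ici 2) := by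
    have hs0 (s : ℝ) (hs : s ∈ Set.Ici (2 : ℝ)) : s ≠ 0 := by
      rw [Set.mem_Ici] at hs; linarith
    exact (continuousOn_const.div continuousOn_id hs0).add
      (continuousOn_const.div (continuousOn_id.mul (Real.continuousOn_log.mono hs0))
        fun s hs => mul_ne_zero (hs0 s hs) (hlog0 s hs).ne')
  set c : ℝ := 100 * (4 * d * C ^ 2 + B) with hcdef
  have hc : 0 ≤ c := by positivity
  have hflux {ψ ψ₁ ψ₂ : ℝ → ℝ} (hψ : IsProfile ψ ψ₁ ψ₂ 50) (t : ℝ) (ht : 3 < t) :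
      |2 * ∫ x, u t x * ψ (x j / θ t) * ptd u t x| ≤ c / (t * Real.log t ^ (1 + ε)) := by
    have hl := one_lt_log_of_three_lt ht
    have hθt : t * Real.log t ^ (1 + ε) ≤ θ t := mul_log_rpow_le_scale hp ε ht
    have h1 : 1 ≤ Real.log t ^ (1 + ε) := Real.one_le_rpow hl.le (by linarith)
    have hθ1 : 1 ≤ θ t := by nlinarith
    have h := hu.abs_integral_mul_ptd_le (by linarith) (hψ.isWeight hθ1 j)
      (hA t (by linarith)) (hA' t (by linarith)) (hB' t (by linarith))
    rw [abs_mul, abs_two]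
    calc 2 * |∫ x, u t x * ψ (x j / θ t) * ptd u t x|
        ≤ 2 * (50 / θ t * (4 * d * C ^ 2 + B)) := by linarith
      _ = c / θ t := by rw [hcdef]; ring
      _ ≤ c / (t * Real.log t ^ (1 + ε)) :=
        div_le_div_of_nonneg_left hc (by nlinarith) hθt
  set g : ℝ → ℝ := fun y => 1 / (1 + y ^ 2) with hgdef
  set η : ℝ → ℝ := fun y => 2 * y ^ 2 / (1 + y ^ 2) ^ 2 with hηdef
  have hη0 (y : ℝ) : 0 ≤ η y := by positivity
  have hg : IsProfile g _ _ 50 := isProfile_inv_one_add_sq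
  have hη : IsProfile η _ _ 50 := isProfile_bump
  have rη (t : ℝ) (ht : 2 ≤ t) : IsRapidlyDecaying fun x => u t x ^ 2 * η (x j / θ t) := by
    have := hη.smooth.continuous
    exact (hS t ht).isRapidlyDecaying.sq.mul_bounded (by fun_prop) fun x => hη.abs_le _
  have rg (t : ℝ) (ht : 2 ≤ t) : IsRapidlyDecaying fun x => u t x ^ 2 * g (x j / θ t) := by
    have := hg.smooth.continuous
    exact (hS t ht).isRapidlyDecaying.sq.mul_bounded (by fun_prop) fun x => hg.abs_le _
  have hlim : Tendsto (fun t => ∫ x, u t x ^ 2 * η (x j / θ t)) atTop (nhds 0) := by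
    refine tendsto_zero_of_bounded_feed (T := 3) (B := C ^ 2) (r := r)
      (K := fun t => ∫ x, u t x ^ 2 * g (x j / θ t))
      (H := fun s => c / ε * Real.log s ^ (-ε)) (h := fun t => c / (t * Real.log t ^ (1 + ε)))
      (by norm_num)
      (fun t ht => hu.hasDerivAt_integral_sq_mul hg hθ hθ0 hrc j (by linarith))
      (fun t ht => hu.hasDerivAt_integral_sq_mul hη hθ hθ0 hrc j (by linarith))
      (fun t ht => hasDerivAt_log_rpow_neg c hε (by linarith))
      (fun t ht => ?_) (fun t ht => ?_) (fun t ht => ?_)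
      (fun t ht => integral_nonneg fun x => mul_nonneg (sq_nonneg _) (hη0 _))
      (fun t ht => ?_) (fun t ht => ?_) ?_
    · have e : ∫ x, u t x ^ 2 * (x j / θ t * (-2 * (x j / θ t) / (1 + (x j / θ t) ^ 2) ^ 2))
          = -∫ x, u t x ^ 2 * η (x j / θ t) := by
        rw [← integral_neg]
        congr 1
        ext x
        simp only [hηdef]
        ring
      rw [e]
      linarith [(abs_le.1 (hflux hg t ht)).1]
    · have hr0 : 0 ≤ r t := by
        have := hlog0 t (by linarith)
        have : 0 < t := by linarith
        positivity
      have e : -(2 * ∫ x, u t x ^ 2 * η (x j / θ t)) ≤ ∫ x, u t x ^ 2 * (x j / θ t *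
          (4 * (x j / θ t) * (1 - (x j / θ t) ^ 2) / (1 + (x j / θ t) ^ 2) ^ 3)) := by
        have hi : Integrable fun x : EuclideanSpace ℝ (Fin d) => u t x ^ 2 * (x j / θ t *
            (4 * (x j / θ t) * (1 - (x j / θ t) ^ 2) / (1 + (x j / θ t) ^ 2) ^ 3)) := by
          have hcont : Continuous fun y : ℝ => y * (4 * y * (1 - y ^ 2) / (1 + y ^ 2) ^ 3) :=
            continuous_id.mul (Continuous.div (by fun_prop) (by fun_prop)
              fun y => by positivity)
          exact ((hS t (by linarith)).isRapidlyDecaying.sq.mul_bounded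
            (g := fun x => x j / θ t *
              (4 * (x j / θ t) * (1 - (x j / θ t) ^ 2) / (1 + (x j / θ t) ^ 2) ^ 3))
            (hcont.comp (by fun_prop : Continuous fun x : EuclideanSpace ℝ (Fin d) => x j / θ t))
            fun x => hη.abs_mul_deriv_le _).integrable (μ := volume)
        rw [← integral_const_mul, ← integral_neg]
        refine integral_mono ((rη t (by linarith)).const_mul 2).integrable.neg hi fun x => ?_
        simp only [hηdef]
        set y := x j / θ t
        have hy : -(2 * (2 * y ^ 2 / (1 + y ^ 2) ^ 2))
            ≤ y * (4 * y * (1 - y ^ 2) / (1 + y ^ 2) ^ 3) := by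
          have : y * (4 * y * (1 - y ^ 2) / (1 + y ^ 2) ^ 3)
              + 2 * (2 * y ^ 2 / (1 + y ^ 2) ^ 2) = 8 * y ^ 2 / (1 + y ^ 2) ^ 3 := by
            field_simp
            ring
          have h2 : 0 ≤ 8 * y ^ 2 / (1 + y ^ 2) ^ 3 := by positivity
          linarith
        nlinarith [mul_le_mul_of_nonneg_left hy (sq_nonneg (u t x))]
      have := mul_le_mul_of_nonneg_left e hr0
      linarith [(abs_le.1 (hflux hη t ht)).2]
    · have ht0 : 0 < t := by linarith
      have := hlog0 t (by linarith)
      have h1 : 0 ≤ (1 + ε) / (t * Real.log t) := by positivity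
      have h2 : 1 / t ≤ p / t := by gcongr
      linarith
    · refine le_trans (integral_mono (rg t (by linarith)).integrable
        (hS t (by linarith)).isRapidlyDecaying.sq.integrable fun x => ?_) (hA t (by linarith))
      refine mul_le_of_le_one_right (sq_nonneg _) ?_
      simp only [hgdef]
      rw [div_le_one (by positivity)]
      nlinarith [sq_nonneg (x j / θ t)]
    · have := hlog0 t (by linarith)
      positivity
    · simpa using ((tendsto_rpow_neg_atTop hε).comp Real.tendsto_log_atTop).const_mul (c / ε)
  set δ : ℝ := 2 * c₁ ^ 2 / (1 + c₂ ^ 2) ^ 2 with hδdef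
  have hδ : 0 < δ := by positivity
  have hbump (y : ℝ) (h₁ : c₁ ≤ |y|) (h₂ : |y| ≤ c₂) : δ ≤ η y := by
    have hy1 : c₁ ^ 2 ≤ y ^ 2 := by rw [← sq_abs y]; gcongr
    have hy2 : y ^ 2 ≤ c₂ ^ 2 := by rw [← sq_abs y]; gcongr
    simp only [hηdef, hδdef]
    gcongr
  refine squeeze_zero' (Eventually.of_forall fun t => integral_nonneg fun x => sq_nonneg _)
    ((eventually_gt_atTop 3).mono fun t ht => ?_) (by simpa using hlim.const_mul δ⁻¹)
  have hθt := hθ0 t (by linarith)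
  have iη := (((rη t (by linarith)).const_mul δ⁻¹).integrable (μ := volume))
  have hmeas : MeasurableSet {x : EuclideanSpace ℝ (Fin d) |
      c₁ * t ^ p * (Real.log t) ^ (1+ε) ≤ |x j| ∧
      |x j| ≤ c₂ * t ^ p * (Real.log t) ^ (1+ε)} := by
    have hcont : Continuous fun x : EuclideanSpace ℝ (Fin d) => |x j| := by fun_prop
    exact ((isClosed_le continuous_const hcont).inter
      (isClosed_le hcont continuous_const)).measurableSet
  rw [← integral_const_mul]
  refine (setIntegral_mono_on (hS t (by linarith)).isRapidlyDecaying.sq.integrable.integrableOn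
    iη.integrableOn hmeas fun x hx => ?_).trans
    (setIntegral_le_integral iη (ae_of_all _ fun x => ?_))
  · have hy : δ ≤ η (x j / θ t) := by
      refine hbump _ ?_ ?_
      · rw [abs_div, abs_of_pos hθt, le_div_iff₀ hθt, ← mul_assoc]
        exact hx.1
      · rw [abs_div, abs_of_pos hθt, div_le_iff₀ hθt, ← mul_assoc]
        exact hx.2
    rw [← div_eq_inv_mul, le_div_iff₀ hδ]
    exact mul_le_mul_of_nonneg_left hy (sq_nonneg _)
  · exact mul_nonneg (inv_nonneg.2 hδ.le) (mul_nonneg (sq_nonneg _) (hη0 _))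
end
end

section
/- Fix b with 0 < b < 2/3, n with 0 ≤ n < 1 − b/2, and a sign ε₀ ∈ {−1, +1}. Let u : ℝ × ℝ → ℝ be an admissible smooth solution on [2,∞) of the quadratic KdV equation ∂_t u + ∂_x(∂_x² u + u²) = 0 with sup_{t≥2} ‖u(t,·)‖_{L²(ℝ)} < ∞. For t ≥ 2 set Ω(t) = { x ∈ ℝ : |x + ε₀ t^n| < t^b }. Then liminf_{t→∞} ∫_{Ω(t)} u(t,x)² dx = 0. -/
open MeasureTheory Filter

noncomputable section

/-- Partial derivative in time of a function `u(t,x)`. -/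
def pt1 (u : ℝ → ℝ → ℝ) : ℝ → ℝ → ℝ := fun t x => deriv (fun s => u s x) t

/-- Partial derivative in space of a function `u(t,x)`. -/
def px1 (u : ℝ → ℝ → ℝ) : ℝ → ℝ → ℝ := fun t x => deriv (fun a => u t a) x

/-- Iterated partial derivatives of `u(t,x)`, indexed by a list of directions
(`0` = t, `1` = x). -/
def D1 (u : ℝ → ℝ → ℝ) : List (Fin 2) → (ℝ → ℝ → ℝ)
  | [] => u
  | i :: l => if i = 0 then pt1 (D1 u l) else px1 (D1 u l)

/-- An admissible smooth solution of the generalized KdV equation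
`∂ₜu + ∂ₓ(∂ₓ²u + u^p) = 0` on `[2,∞)`: it is `C^∞`, solves the equation pointwise
for `t ≥ 2`, and all iterated partial derivatives decay in space faster than any
polynomial, locally uniformly in time. -/
structure IsAdmissibleGKdV (p : ℕ) (u : ℝ → ℝ → ℝ) : Prop where
  smooth : ContDiff ℝ (⊤ : ℕ∞) (fun q : ℝ × ℝ => u q.1 q.2)
  eqn : ∀ t x : ℝ, 2 ≤ t →
    pt1 u t x + px1 (fun t' x' => px1 (px1 u) t' x' + (u t' x') ^ p) t x = 0
  decay : ∀ (l : List (Fin 2)) (N : ℕ) (a b : ℝ), 2 ≤ a →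
    ∃ C : ℝ, ∀ t x : ℝ, t ∈ Set.Icc a b →
      (1 + |x|) ^ N * |D1 u l t x| ≤ C

/-- Continuous functions on the line that are `O((1 + x²)⁻¹)`. -/
def QuadDecay (f : ℝ → ℝ) : Prop :=
  Continuous f ∧ ∃ C : ℝ, ∀ x, (1 + x ^ 2) * |f x| ≤ C

theorem abs_le_of_one_add_sq_mul_le {x y C : ℝ} (h : (1 + x ^ 2) * |y| ≤ C) :
    |y| ≤ C * (1 + x ^ 2)⁻¹ := by
  rw [← div_eq_mul_inv, le_div_iff₀ (by positivity)]
  linarith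

theorem QuadDecay.integrable_mul {f g : ℝ → ℝ} (hf : QuadDecay f) (hg : Continuous g) {B : ℝ}
    (hB : ∀ x, |g x| ≤ B) : Integrable (fun x => f x * g x) := by
  obtain ⟨hc, C, hC⟩ := hf
  refine ((integrable_inv_one_add_sq.const_mul (C * B))).mono'
    (hc.mul hg).aestronglyMeasurable (Eventually.of_forall fun x => ?_)
  have h1 := abs_le_of_one_add_sq_mul_le (hC x)
  rw [Real.norm_eq_abs, abs_mul]
  calc |f x| * |g x| ≤ (C * (1 + x ^ 2)⁻¹) * B :=
        mul_le_mul h1 (hB x) (abs_nonneg _) ((abs_nonneg _).trans h1)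
    _ = _ := by ring

theorem QuadDecay.bounded {f : ℝ → ℝ} (hf : QuadDecay f) : ∃ B, ∀ x, |f x| ≤ B := by
  obtain ⟨hc, C, hC⟩ := hf
  refine ⟨C, fun x => le_trans ?_ (hC x)⟩
  nlinarith [abs_nonneg (f x), mul_nonneg (sq_nonneg x) (abs_nonneg (f x))]

theorem QuadDecay.integrable_sq {f : ℝ → ℝ} (hf : QuadDecay f) :
    Integrable (fun x => f x ^ 2) := by
  obtain ⟨B, hB⟩ := hf.bounded
  simpa only [sq] using hf.integrable_mul hf.1 hB

theorem QuadDecay.sq {f : ℝ → ℝ} (hf : QuadDecay f) : QuadDecay (fun x => f x ^ 2) := by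
  obtain ⟨B, hB⟩ := hf.bounded
  obtain ⟨hc, C, hC⟩ := hf
  refine ⟨hc.pow 2, C * B, fun x => ?_⟩
  rw [abs_pow, pow_two |f x|, ← mul_assoc]
  exact mul_le_mul (hC x) (hB x) (abs_nonneg _) (le_trans (by positivity) (hC x))

theorem QuadDecay.add {f g : ℝ → ℝ} (hf : QuadDecay f) (hg : QuadDecay g) :
    QuadDecay (fun x => f x + g x) := by
  obtain ⟨hc, C, hC⟩ := hf
  obtain ⟨hc', C', hC'⟩ := hg
  refine ⟨hc.add hc', C + C', fun x => ?_⟩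
  have := mul_le_mul_of_nonneg_left (abs_add_le (f x) (g x)) (by positivity : 0 ≤ 1 + x ^ 2)
  linarith [hC x, hC' x]

theorem QuadDecay.integral_deriv_mul {f f' g g' : ℝ → ℝ} (hf : QuadDecay f) (hf' : QuadDecay f')
    (hg : Continuous g) (hg' : Continuous g') {B B' : ℝ} (hB : ∀ x, |g x| ≤ B)
    (hB' : ∀ x, |g' x| ≤ B') (hd : ∀ x, HasDerivAt f (f' x) x)
    (hd' : ∀ x, HasDerivAt g (g' x) x) :
    ∫ x, f' x * g x = -∫ x, f x * g' x := by
  rw [integral_mul_deriv_eq_deriv_mul_of_integrable (fun x _ => hd x) (fun x _ => hd' x)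
    (hf.integrable_mul hg' hB') (hf'.integrable_mul hg hB) (hf.integrable_mul hg hB), neg_neg]

/-- First derivative of `arctan`. -/
def arctanD1 (s : ℝ) : ℝ := (1 + s ^ 2)⁻¹

/-- Second derivative of `arctan`. -/
def arctanD2 (s : ℝ) : ℝ := -2 * s * (1 + s ^ 2)⁻¹ ^ 2

/-- Third derivative of `arctan`. -/
def arctanD3 (s : ℝ) : ℝ := (6 * s ^ 2 - 2) * (1 + s ^ 2)⁻¹ ^ 3

theorem continuous_arctanD1 : Continuous arctanD1 := by
  unfold arctanD1
  exact (by fun_prop : Continuous fun s : ℝ => 1 + s ^ 2).inv₀ fun s => by positivity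

theorem continuous_arctanD2 : Continuous arctanD2 := by
  have := continuous_arctanD1
  unfold arctanD1 at this
  unfold arctanD2
  fun_prop

theorem continuous_arctanD3 : Continuous arctanD3 := by
  have := continuous_arctanD1
  unfold arctanD1 at this
  unfold arctanD3
  fun_prop

theorem hasDerivAt_arctan_arctanD1 (s : ℝ) : HasDerivAt Real.arctan (arctanD1 s) s := by
  simpa [arctanD1] using Real.hasDerivAt_arctan s

theorem hasDerivAt_arctanD1 (s : ℝ) : HasDerivAt arctanD1 (arctanD2 s) s := by
  have h : HasDerivAt (fun s : ℝ => 1 + s ^ 2) (2 * s) s := by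
    simpa using ((hasDerivAt_id s).pow 2).const_add 1
  refine (h.inv (by positivity)).congr_deriv ?_
  unfold arctanD2
  field_simp

theorem hasDerivAt_arctanD2 (s : ℝ) : HasDerivAt arctanD2 (arctanD3 s) s := by
  have h := ((hasDerivAt_id s).const_mul (-2)).mul ((hasDerivAt_arctanD1 s).pow 2)
  refine h.congr_deriv ?_
  have : (1 + s ^ 2) ≠ 0 := by positivity
  simp only [arctanD1, arctanD2, arctanD3, id, Pi.pow_apply]
  norm_num
  field_simp
  ring

theorem arctanD1_pos (s : ℝ) : 0 < arctanD1 s := by unfold arctanD1; positivity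

theorem arctanD1_le_one (s : ℝ) : arctanD1 s ≤ 1 :=
  inv_le_one_of_one_le₀ (by nlinarith [sq_nonneg s])

theorem one_add_sq_mul_arctanD1 (s : ℝ) : (1 + s ^ 2) * arctanD1 s = 1 :=
  mul_inv_cancel₀ (by positivity)

theorem abs_arctanD1_le (s : ℝ) : |arctanD1 s| ≤ 1 := by
  rw [abs_of_pos (arctanD1_pos s)]
  exact arctanD1_le_one s

theorem abs_mul_arctanD1_le (s : ℝ) : |s * arctanD1 s| ≤ 1 := by
  rw [abs_mul, abs_of_pos (arctanD1_pos s)]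
  have h := one_add_sq_mul_arctanD1 s
  have h0 := arctanD1_pos s
  have : |s| ≤ 1 + s ^ 2 := by nlinarith [sq_abs s, sq_nonneg (|s| - 1), abs_nonneg s]
  nlinarith

theorem abs_arctanD2_le (s : ℝ) : |arctanD2 s| ≤ 2 := by
  have : arctanD2 s = -2 * ((s * arctanD1 s) * arctanD1 s) := by
    unfold arctanD2 arctanD1; ring
  rw [this, abs_mul, abs_mul]
  have h1 := abs_mul_arctanD1_le s
  have h2 := abs_arctanD1_le s
  have := mul_le_mul h1 h2 (abs_nonneg _) zero_le_one
  rw [abs_neg, abs_two]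
  linarith

theorem arctanD3_eq (s : ℝ) : arctanD3 s = arctanD1 s ^ 2 * (6 - 8 * arctanD1 s) := by
  have h := one_add_sq_mul_arctanD1 s
  have : arctanD3 s = (6 * s ^ 2 - 2) * arctanD1 s ^ 3 := rfl
  rw [this]
  linear_combination 6 * arctanD1 s ^ 2 * h

theorem sq_six_sub_le {j : ℝ} (h0 : 0 < j) (h1 : j ≤ 1) : (6 - 8 * j) ^ 2 ≤ 36 := by
  nlinarith

theorem abs_arctanD3_le (s : ℝ) : |arctanD3 s| ≤ 6 := by
  have h0 := arctanD1_pos s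
  have h1 := arctanD1_le_one s
  rw [arctanD3_eq, abs_mul, abs_of_pos (pow_pos h0 2)]
  have : |6 - 8 * arctanD1 s| ≤ 6 := by rw [abs_le]; constructor <;> linarith
  have h2 : arctanD1 s ^ 2 ≤ 1 := pow_le_one₀ h0.le h1
  calc _ ≤ 1 * (6 : ℝ) := mul_le_mul h2 this (abs_nonneg _) zero_le_one
    _ = 6 := by norm_num

theorem arctanD1_sq_mul_le (s : ℝ) : arctanD1 s ^ 2 * (1 + s ^ 2) ≤ 36 := by
  have h := one_add_sq_mul_arctanD1 s
  have h1 := arctanD1_le_one s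
  have : arctanD1 s ^ 2 * (1 + s ^ 2) = arctanD1 s := by linear_combination arctanD1 s * h
  linarith

theorem mul_arctanD1_sq_mul_le (s : ℝ) : (s * arctanD1 s) ^ 2 * (1 + s ^ 2) ≤ 36 := by
  have h := one_add_sq_mul_arctanD1 s
  have h1 := arctanD1_pos s
  have : (s * arctanD1 s) ^ 2 * (1 + s ^ 2) = 1 - arctanD1 s := by
    linear_combination (s ^ 2 * arctanD1 s + 1) * h
  linarith

theorem arctanD3_sq_mul_le (s : ℝ) : arctanD3 s ^ 2 * (1 + s ^ 2) ≤ 36 := by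
  have h := one_add_sq_mul_arctanD1 s
  have h0 := arctanD1_pos s
  have h1 := arctanD1_le_one s
  have : arctanD3 s ^ 2 * (1 + s ^ 2) = arctanD1 s ^ 3 * (6 - 8 * arctanD1 s) ^ 2 := by
    rw [arctanD3_eq]
    linear_combination arctanD1 s ^ 3 * (6 - 8 * arctanD1 s) ^ 2 * h
  rw [this]
  calc _ ≤ 1 * (36 : ℝ) := mul_le_mul (pow_le_one₀ h0.le h1) (sq_six_sub_le h0 h1)
        (sq_nonneg _) zero_le_one
    _ = 36 := by norm_num

theorem abs_arctan_le_two (s : ℝ) : |Real.arctan s| ≤ 2 := by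
  have := Real.pi_lt_four
  rw [abs_le]
  constructor <;> linarith [Real.neg_pi_div_two_lt_arctan s, Real.arctan_lt_pi_div_two s]

theorem mul_arctan_sub_le {p q : ℝ} (hq : 0 ≤ q) (hpq : q ≤ p) :
    q * (Real.arctan p - Real.arctan q) ≤ 1 := by
  rcases hq.eq_or_lt with rfl | hq
  · simp
  have h1 : Real.arctan q⁻¹ ≤ q⁻¹ := by
    have := Real.le_tan (x := Real.arctan q⁻¹) (Real.arctan_nonneg.2 (by positivity))
      (Real.arctan_lt_pi_div_two _)
    rwa [Real.tan_arctan] at this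
  rw [Real.arctan_inv_of_pos hq] at h1
  have h2 : Real.arctan p - Real.arctan q ≤ q⁻¹ := by linarith [Real.arctan_lt_pi_div_two p]
  calc _ ≤ q * q⁻¹ := by gcongr
    _ = 1 := mul_inv_cancel₀ hq.ne'

theorem arctan_sub_sq_mul_le {y k l : ℝ} (hl : 0 ≤ l) (hlk : l ≤ k) :
    (Real.arctan (y * k) - Real.arctan (y * l)) ^ 2 * (1 + (y * l) ^ 2) ≤ 36 := by
  have h1 : |Real.arctan (y * k) - Real.arctan (y * l)| ≤ 4 := by
    have := abs_sub (Real.arctan (y * k)) (Real.arctan (y * l))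
    linarith [abs_arctan_le_two (y * k), abs_arctan_le_two (y * l)]
  have h2 : |y * l * (Real.arctan (y * k) - Real.arctan (y * l))| ≤ 1 := by
    have key : ∀ z : ℝ, 0 ≤ z →
        |z * l * (Real.arctan (z * k) - Real.arctan (z * l))| ≤ 1 := by
      intro z hz
      have h3 : z * l ≤ z * k := by gcongr
      rw [abs_of_nonneg]
      · exact mul_arctan_sub_le (by positivity) h3
      · exact mul_nonneg (by positivity) (sub_nonneg.2 (Real.arctan_mono h3))
    rcases le_total 0 y with hy | hy
    · exact key y hy
    · have := key (-y) (by linarith)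
      simp only [neg_mul, Real.arctan_neg] at this
      convert this using 2
      ring
  have h3 := pow_le_pow_left₀ (abs_nonneg _) h1 2
  have h4 := pow_le_pow_left₀ (abs_nonneg _) h2 2
  rw [sq_abs] at h3 h4
  nlinarith

theorem integrable_arctanD1_affine (r : ℝ) {k : ℝ} (hk : 0 < k) :
    Integrable (fun x => arctanD1 ((x + r) * k)) :=
  (integrable_inv_one_add_sq.comp_mul_right' hk.ne').comp_add_right r

theorem integral_arctanD1_affine (r : ℝ) {k : ℝ} (hk : 0 < k) :
    ∫ x, arctanD1 ((x + r) * k) = k⁻¹ * Real.pi := by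
  rw [integral_add_right_eq_self (fun x => arctanD1 (x * k)) r,
    Measure.integral_comp_mul_right arctanD1 k]
  unfold arctanD1
  rw [integral_univ_inv_one_add_sq, abs_of_pos (inv_pos.2 hk), smul_eq_mul]

/-- A Cauchy–Schwarz bound against a weight dominated by a rescaled Lorentzian. -/
theorem abs_integral_mul_le_of_sq_mul_le {U f : ℝ → ℝ} {C r κ : ℝ}
    (hU : Integrable (fun x => U x ^ 2)) (hC : ∫ x, U x ^ 2 ≤ C) (hκ : 0 < κ)
    (hf : ∀ x, f x ^ 2 * (1 + ((x + r) * (κ ^ 2)⁻¹) ^ 2) ≤ 36) :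
    |∫ x, U x * f x| ≤ (C + 36 * Real.pi) / 2 * κ := by
  have hk : 0 < (κ ^ 2)⁻¹ := by positivity
  have hI := integrable_arctanD1_affine r hk
  have hg : Integrable (fun x => κ / 2 * U x ^ 2 + 18 / κ * arctanD1 ((x + r) * (κ ^ 2)⁻¹)) :=
    (hU.const_mul _).add (hI.const_mul _)
  rw [← Real.norm_eq_abs]
  refine (norm_integral_le_of_norm_le hg (Eventually.of_forall fun x => ?_)).trans ?_
  · have h1 := hf x
    have h2 : f x ^ 2 ≤ 36 * arctanD1 ((x + r) * (κ ^ 2)⁻¹) := by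
      unfold arctanD1
      rw [← div_eq_mul_inv, le_div_iff₀ (by positivity)]
      exact h1
    have h3 : |U x * f x| ≤ κ / 2 * U x ^ 2 + 1 / (2 * κ) * f x ^ 2 := by
      rw [abs_mul, ← sq_abs (U x), ← sq_abs (f x)]
      have : κ / 2 * |U x| ^ 2 + 1 / (2 * κ) * |f x| ^ 2 - |U x| * |f x|
          = (κ * |U x| - |f x|) ^ 2 / (2 * κ) := by field_simp; ring
      have h : 0 ≤ (κ * |U x| - |f x|) ^ 2 / (2 * κ) := by positivity
      linarith
    have h4 : 1 / (2 * κ) * f x ^ 2 ≤ 1 / (2 * κ) * (36 * arctanD1 ((x + r) * (κ ^ 2)⁻¹)) := by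
      gcongr
    have h5 : 1 / (2 * κ) * (36 * arctanD1 ((x + r) * (κ ^ 2)⁻¹))
        = 18 / κ * arctanD1 ((x + r) * (κ ^ 2)⁻¹) := by ring
    rw [Real.norm_eq_abs]
    linarith
  · rw [integral_add (hU.const_mul _) (hI.const_mul _), integral_const_mul, integral_const_mul,
      integral_arctanD1_affine r hk]
    have h1 : 18 / κ * ((κ ^ 2)⁻¹⁻¹ * Real.pi) = 18 * Real.pi * κ := by
      field_simp
    have h2 : κ / 2 * ∫ x, U x ^ 2 ≤ κ / 2 * C := by gcongr
    rw [h1]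
    linarith

theorem hasDerivAt_comp_affine {A A' : ℝ → ℝ} (hA : ∀ s, HasDerivAt A (A' s) s) (r k x : ℝ) :
    HasDerivAt (fun x => A ((x + r) * k)) (k * A' ((x + r) * k)) x := by
  have h : HasDerivAt (fun x => (x + r) * k) k x := by
    simpa using ((hasDerivAt_id x).add_const r).mul_const k
  exact ((hA _).comp x h).congr_deriv (mul_comm _ _)

/-- Integration by parts for the KdV flux against a rescaled `arctan`. -/
theorem integral_flux_deriv_mul_arctan {U U1 U2 G1 : ℝ → ℝ} (r k : ℝ)
    (h0 : QuadDecay U) (h1 : QuadDecay U1) (h2 : QuadDecay U2) (hG : QuadDecay G1)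
    (d0 : ∀ x, HasDerivAt U (U1 x) x) (d1 : ∀ x, HasDerivAt U1 (U2 x) x)
    (dG : ∀ x, HasDerivAt (fun x => U2 x + U x ^ 2) (G1 x) x) :
    ∫ x, G1 x * Real.arctan ((x + r) * k)
      = -(k * ∫ x, U x ^ 2 * arctanD1 ((x + r) * k))
        - k ^ 3 * ∫ x, U x * arctanD3 ((x + r) * k) := by
  have cA : Continuous fun x : ℝ => (x + r) * k := by fun_prop
  have c0 := Real.continuous_arctan.comp cA
  have c1 := continuous_arctanD1.comp cA
  have c2 := continuous_arctanD2.comp cA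
  have c3 := continuous_arctanD3.comp cA
  have e1 := (h2.add h0.sq).integral_deriv_mul hG c0 (c1.const_mul k)
    (fun x => abs_arctan_le_two _)
    (B' := |k| * 1) (fun x => by
      rw [abs_mul]; exact mul_le_mul_of_nonneg_left (abs_arctanD1_le _) (abs_nonneg _)) dG
    (hasDerivAt_comp_affine hasDerivAt_arctan_arctanD1 r k)
  have e2 := h1.integral_deriv_mul h2 c1 (c2.const_mul k) (fun x => abs_arctanD1_le _)
    (B' := |k| * 2) (fun x => by
      rw [abs_mul]; exact mul_le_mul_of_nonneg_left (abs_arctanD2_le _) (abs_nonneg _)) d1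
    (hasDerivAt_comp_affine hasDerivAt_arctanD1 r k)
  have e3 := h0.integral_deriv_mul h1 c2 (c3.const_mul k) (fun x => abs_arctanD2_le _)
    (B' := |k| * 6) (fun x => by
      rw [abs_mul]; exact mul_le_mul_of_nonneg_left (abs_arctanD3_le _) (abs_nonneg _)) d0
    (hasDerivAt_comp_affine hasDerivAt_arctanD2 r k)
  simp only [Function.comp_def] at e1 e2 e3
  simp only [mul_left_comm _ k, integral_const_mul] at e1 e2 e3
  have e4 : ∫ x, (U2 x + U x ^ 2) * arctanD1 ((x + r) * k)
      = (∫ x, U2 x * arctanD1 ((x + r) * k)) + ∫ x, U x ^ 2 * arctanD1 ((x + r) * k) := by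
    refine (integral_congr_ae (Eventually.of_forall fun x => add_mul _ _ _)).trans ?_
    exact integral_add (h2.integrable_mul c1 fun x => abs_arctanD1_le _)
      (h0.sq.integrable_mul c1 fun x => abs_arctanD1_le _)
  rw [e1, e4, e2, e3]
  ring

section Regularity

variable {v : ℝ → ℝ → ℝ}

theorem hasDerivAt_fst (hv : ContDiff ℝ (⊤ : ℕ∞) fun q : ℝ × ℝ => v q.1 q.2) (t x : ℝ) :
    HasDerivAt (fun s => v s x) (fderiv ℝ (fun q : ℝ × ℝ => v q.1 q.2) (t, x) (1, 0)) t :=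
  ((hv.differentiable (by simp)) (t, x)).hasFDerivAt.comp_hasDerivAt (f := fun s => (s, x)) t
    ((hasDerivAt_id t).prodMk (hasDerivAt_const t x))

theorem hasDerivAt_snd (hv : ContDiff ℝ (⊤ : ℕ∞) fun q : ℝ × ℝ => v q.1 q.2) (t x : ℝ) :
    HasDerivAt (fun a => v t a) (fderiv ℝ (fun q : ℝ × ℝ => v q.1 q.2) (t, x) (0, 1)) x :=
  ((hv.differentiable (by simp)) (t, x)).hasFDerivAt.comp_hasDerivAt x
    ((hasDerivAt_const x t).prodMk (hasDerivAt_id x))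

theorem hasDerivAt_pt1 (hv : ContDiff ℝ (⊤ : ℕ∞) fun q : ℝ × ℝ => v q.1 q.2) (t x : ℝ) :
    HasDerivAt (fun s => v s x) (pt1 v t x) t :=
  (hasDerivAt_fst hv t x).differentiableAt.hasDerivAt

theorem hasDerivAt_px1 (hv : ContDiff ℝ (⊤ : ℕ∞) fun q : ℝ × ℝ => v q.1 q.2) (t x : ℝ) :
    HasDerivAt (fun a => v t a) (px1 v t x) x :=
  (hasDerivAt_snd hv t x).differentiableAt.hasDerivAt

theorem contDiff_pt1 (hv : ContDiff ℝ (⊤ : ℕ∞) fun q : ℝ × ℝ => v q.1 q.2) :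
    ContDiff ℝ (⊤ : ℕ∞) fun q : ℝ × ℝ => pt1 v q.1 q.2 := by
  have : (fun q : ℝ × ℝ => pt1 v q.1 q.2)
      = fun q => fderiv ℝ (fun q : ℝ × ℝ => v q.1 q.2) q (1, 0) := by
    ext q
    exact (hasDerivAt_fst hv q.1 q.2).deriv
  rw [this]
  exact (hv.fderiv_right (by simp)).clm_apply contDiff_const

theorem contDiff_px1 (hv : ContDiff ℝ (⊤ : ℕ∞) fun q : ℝ × ℝ => v q.1 q.2) :
    ContDiff ℝ (⊤ : ℕ∞) fun q : ℝ × ℝ => px1 v q.1 q.2 := by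
  have : (fun q : ℝ × ℝ => px1 v q.1 q.2)
      = fun q => fderiv ℝ (fun q : ℝ × ℝ => v q.1 q.2) q (0, 1) := by
    ext q
    exact (hasDerivAt_snd hv q.1 q.2).deriv
  rw [this]
  exact (hv.fderiv_right (by simp)).clm_apply contDiff_const

theorem contDiff_D1 (hv : ContDiff ℝ (⊤ : ℕ∞) fun q : ℝ × ℝ => v q.1 q.2) (l : List (Fin 2)) :
    ContDiff ℝ (⊤ : ℕ∞) fun q : ℝ × ℝ => D1 v l q.1 q.2 := by
  induction l with
  | nil => exact hv
  | cons i l ih =>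
    by_cases hi : i = 0
    · simpa only [D1, if_pos hi] using contDiff_pt1 ih
    · simpa only [D1, if_neg hi] using contDiff_px1 ih

end Regularity

theorem IsAdmissibleGKdV.exists_uniform_bound {p : ℕ} {u : ℝ → ℝ → ℝ}
    (hu : IsAdmissibleGKdV p u) (l : List (Fin 2)) {a b : ℝ} (ha : 2 ≤ a) :
    ∃ C : ℝ, ∀ t ∈ Set.Icc a b, ∀ x, (1 + x ^ 2) * |D1 u l t x| ≤ C := by
  obtain ⟨C, hC⟩ := hu.decay l 2 a b ha
  refine ⟨C, fun t ht x => (mul_le_mul_of_nonneg_right ?_ (abs_nonneg _)).trans (hC t x ht)⟩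
  nlinarith [sq_abs x, abs_nonneg x]

theorem IsAdmissibleGKdV.quadDecay {p : ℕ} {u : ℝ → ℝ → ℝ} (hu : IsAdmissibleGKdV p u)
    (l : List (Fin 2)) {t : ℝ} (ht : 2 ≤ t) : QuadDecay (D1 u l t) := by
  obtain ⟨C, hC⟩ := hu.exists_uniform_bound l (b := t) ht
  exact ⟨(contDiff_D1 hu.smooth l).continuous.comp (by fun_prop : Continuous fun x => (t, x)),
    C, hC t ⟨le_rfl, le_rfl⟩⟩

/-- Time derivative of the moving, rescaled argument `(x + ε τ ^ n) * τ ^ (-c)`. -/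
theorem hasDerivAt_moving_arctan (ε n c x : ℝ) {τ : ℝ} (hτ : 0 < τ) :
    HasDerivAt (fun τ : ℝ => Real.arctan ((x + ε * τ ^ n) * τ ^ (-c)))
      (ε * n * τ ^ (n - 1) * τ ^ (-c) * arctanD1 ((x + ε * τ ^ n) * τ ^ (-c))
        + -(c * τ⁻¹) * ((x + ε * τ ^ n) * τ ^ (-c) * arctanD1 ((x + ε * τ ^ n) * τ ^ (-c)))) τ := by
  have h1 := ((Real.hasDerivAt_rpow_const (p := n) (Or.inl hτ.ne')).const_mul ε).const_add x
  have h2 := Real.hasDerivAt_rpow_const (p := -c) (Or.inl hτ.ne')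
  refine ((hasDerivAt_arctan_arctanD1 _).comp τ (h1.mul h2)).congr_deriv ?_
  rw [Real.rpow_sub_one hτ.ne' (-c)]
  simp only [Pi.mul_apply]
  ring

/-- The moment of a solution of the quadratic KdV equation against a moving, rescaled `arctan` is
differentiable; its derivative is a localized mass up to an explicit error. -/
theorem IsAdmissibleGKdV.exists_hasDerivAt_moment {u : ℝ → ℝ → ℝ} (hu : IsAdmissibleGKdV 2 u)
    {C ε n c : ℝ} (hC : ∀ t : ℝ, 2 ≤ t → (∫ x : ℝ, (u t x) ^ 2) ≤ C) (hε : |ε| = 1)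
    (hn₀ : 0 ≤ n) (hn₁ : n ≤ 1) (hc₀ : 0 ≤ c) (hc₁ : c ≤ 1) {t : ℝ} (ht : 3 < t) :
    ∃ E : ℝ, HasDerivAt (fun τ => ∫ x, u τ x * Real.arctan ((x + ε * τ ^ n) * τ ^ (-c)))
        (t ^ (-c) * (∫ x, u t x ^ 2 * arctanD1 ((x + ε * t ^ n) * t ^ (-c))) + E) t ∧
      |E| ≤ (C + 36 * Real.pi) / 2 * t ^ (c / 2) *
        ((t ^ (-c)) ^ 3 + t ^ (n - 1) * t ^ (-c) + t⁻¹) := by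
  have ht0 : 0 < t := by linarith
  have ht2 : 2 ≤ t := by linarith
  obtain ⟨K0, hK0⟩ := hu.exists_uniform_bound [] (a := 2) (b := t + 1) le_rfl
  obtain ⟨K1, hK1⟩ := hu.exists_uniform_bound [0] (a := 2) (b := t + 1) le_rfl
  have hball : ∀ τ ∈ Metric.ball t 1, τ ∈ Set.Icc 2 (t + 1) := by
    intro τ hτ
    rw [Real.ball_eq_Ioo] at hτ
    exact ⟨by linarith [hτ.1], hτ.2.le⟩
  have cA : ∀ τ : ℝ, Continuous fun x : ℝ => (x + ε * τ ^ n) * τ ^ (-c) := by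
    intro τ; fun_prop
  have c0 : ∀ τ : ℝ, Continuous fun x : ℝ => Real.arctan ((x + ε * τ ^ n) * τ ^ (-c)) :=
    fun τ => Real.continuous_arctan.comp (cA τ)
  have c1 : ∀ τ : ℝ, Continuous fun x : ℝ => arctanD1 ((x + ε * τ ^ n) * τ ^ (-c)) :=
    fun τ => continuous_arctanD1.comp (cA τ)
  have q0 : QuadDecay (u t) := hu.quadDecay [] ht2
  have qt : QuadDecay (pt1 u t) := hu.quadDecay [0] ht2
  have qx : QuadDecay (px1 u t) := hu.quadDecay [1] ht2
  have qxx : QuadDecay (px1 (px1 u) t) := hu.quadDecay [1, 1] ht2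
  have hcoef : ∀ τ : ℝ, 1 ≤ τ → |ε * n * τ ^ (n - 1) * τ ^ (-c)| ≤ τ ^ (n - 1) * τ ^ (-c) ∧
      |-(c * τ⁻¹)| ≤ τ⁻¹ := by
    intro τ hτ
    have hτ0 : 0 < τ := by linarith
    constructor
    · rw [abs_mul, abs_mul, abs_mul, hε, abs_of_nonneg hn₀, abs_of_nonneg (by positivity),
        abs_of_nonneg (by positivity), one_mul]
      have : 0 ≤ τ ^ (n - 1) * τ ^ (-c) := by positivity
      nlinarith
    · rw [abs_neg, abs_of_nonneg (by positivity)]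
      have : 0 < τ⁻¹ := by positivity
      nlinarith
  set F' : ℝ → ℝ → ℝ := fun τ x =>
    pt1 u τ x * Real.arctan ((x + ε * τ ^ n) * τ ^ (-c)) +
      u τ x * (ε * n * τ ^ (n - 1) * τ ^ (-c) * arctanD1 ((x + ε * τ ^ n) * τ ^ (-c))
        + -(c * τ⁻¹) * ((x + ε * τ ^ n) * τ ^ (-c) * arctanD1 ((x + ε * τ ^ n) * τ ^ (-c))))
    with hF'
  have hF'c : Continuous (F' t) := by
    have := q0.1
    have := qt.1
    have := c0 t
    have := c1 t
    have := cA t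
    simp only [hF']
    fun_prop
  have key := hasDerivAt_integral_of_dominated_loc_of_deriv_le (μ := volume) (𝕜 := ℝ)
    (F := fun τ x => u τ x * Real.arctan ((x + ε * τ ^ n) * τ ^ (-c))) (F' := F') (x₀ := t)
    (bound := fun x => (2 * K1 + 2 * K0) * (1 + x ^ 2)⁻¹)
    (Metric.ball_mem_nhds t one_pos)
    (Eventually.of_forall fun τ => by
      have h1 : Continuous (u τ) :=
        hu.smooth.continuous.comp (by fun_prop : Continuous fun x => (τ, x))
      exact (h1.mul (c0 τ)).aestronglyMeasurable)
    (q0.integrable_mul (c0 t) fun x => abs_arctan_le_two _)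
    hF'c.aestronglyMeasurable
    (Eventually.of_forall fun x τ hτ => by
      have hI := hball τ hτ
      have h1 : 1 ≤ τ := by linarith [hI.1]
      have b0 := abs_le_of_one_add_sq_mul_le (hK0 τ hI x)
      have b1 := abs_le_of_one_add_sq_mul_le (hK1 τ hI x)
      simp only [D1, if_true] at b0 b1
      obtain ⟨k1, k2⟩ := hcoef τ h1
      have k3 : τ ^ (n - 1) * τ ^ (-c) ≤ 1 := mul_le_one₀
        (Real.rpow_le_one_of_one_le_of_nonpos h1 (by linarith)) (by positivity)
        (Real.rpow_le_one_of_one_le_of_nonpos h1 (by linarith))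
      have k4 : τ⁻¹ ≤ 1 := inv_le_one_of_one_le₀ h1
      have e1 := abs_arctanD1_le ((x + ε * τ ^ n) * τ ^ (-c))
      have e2 := abs_mul_arctanD1_le ((x + ε * τ ^ n) * τ ^ (-c))
      have e0 := abs_arctan_le_two ((x + ε * τ ^ n) * τ ^ (-c))
      rw [Real.norm_eq_abs]
      refine (abs_add_le _ _).trans ?_
      rw [abs_mul, abs_mul]
      have f2 : |ε * n * τ ^ (n - 1) * τ ^ (-c) * arctanD1 ((x + ε * τ ^ n) * τ ^ (-c))
        + -(c * τ⁻¹) * ((x + ε * τ ^ n) * τ ^ (-c) * arctanD1 ((x + ε * τ ^ n) * τ ^ (-c)))|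
          ≤ 2 := by
        refine (abs_add_le _ _).trans ?_
        rw [abs_mul _ (arctanD1 _), abs_mul (-(c * τ⁻¹))]
        have := mul_le_one₀ (k1.trans k3) (abs_nonneg _) e1
        have := mul_le_one₀ (k2.trans k4) (abs_nonneg _) e2
        linarith
      have g1 := mul_le_mul b1 e0 (abs_nonneg _) ((abs_nonneg _).trans b1)
      have g2 := mul_le_mul b0 f2 (abs_nonneg _) ((abs_nonneg _).trans b0)
      linarith)
    (integrable_inv_one_add_sq.const_mul _)
    (Eventually.of_forall fun x τ hτ => by
      have h1 : 0 < τ := by linarith [(hball τ hτ).1]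
      exact (hasDerivAt_pt1 hu.smooth τ x).mul (hasDerivAt_moving_arctan ε n c x h1))
  have hflux : ∀ x, HasDerivAt (fun x => px1 (px1 u) t x + u t x ^ 2) (-pt1 u t x) x := by
    intro x
    have hd : DifferentiableAt ℝ (fun x => px1 (px1 u) t x + u t x ^ 2) x :=
      (hasDerivAt_px1 (contDiff_px1 (contDiff_px1 hu.smooth)) t x).differentiableAt.add
        ((hasDerivAt_px1 hu.smooth t x).differentiableAt.pow 2)
    have h := hd.hasDerivAt
    have e := hu.eqn t x ht2
    have : deriv (fun x => px1 (px1 u) t x + u t x ^ 2) x = -pt1 u t x :=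
      eq_neg_of_add_eq_zero_right e
    rwa [this] at h
  have qG : QuadDecay fun x => -pt1 u t x := by
    obtain ⟨hc, K, hK⟩ := qt
    exact ⟨hc.neg, K, fun x => by simpa only [abs_neg] using hK x⟩
  have hI := integral_flux_deriv_mul_arctan (ε * t ^ n) (t ^ (-c)) q0 qx qxx qG
    (hasDerivAt_px1 hu.smooth t) (hasDerivAt_px1 (contDiff_px1 hu.smooth) t) hflux
  simp only [neg_mul, integral_neg] at hI
  have i1 := q0.integrable_mul (c1 t) fun x => abs_arctanD1_le _
  have i2 : Integrable fun x => u t x *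
      ((x + ε * t ^ n) * t ^ (-c) * arctanD1 ((x + ε * t ^ n) * t ^ (-c))) := q0.integrable_mul ((cA t).mul (c1 t)) fun x => abs_mul_arctanD1_le _
  have i3 : Integrable fun x =>
      ε * n * t ^ (n - 1) * t ^ (-c) * (u t x * arctanD1 ((x + ε * t ^ n) * t ^ (-c)))
      + -(c * t⁻¹) * (u t x *
        ((x + ε * t ^ n) * t ^ (-c) * arctanD1 ((x + ε * t ^ n) * t ^ (-c)))) :=
    (i1.const_mul _).add (i2.const_mul _)
  have hsplit : ∫ x, F' t x = (∫ x, pt1 u t x * Real.arctan ((x + ε * t ^ n) * t ^ (-c)))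
      + (ε * n * t ^ (n - 1) * t ^ (-c) *
          (∫ x, u t x * arctanD1 ((x + ε * t ^ n) * t ^ (-c)))
        + -(c * t⁻¹) * ∫ x, u t x *
          ((x + ε * t ^ n) * t ^ (-c) * arctanD1 ((x + ε * t ^ n) * t ^ (-c)))) := by
    rw [← integral_const_mul, ← integral_const_mul,
      ← integral_add (i1.const_mul _) (i2.const_mul _),
      ← integral_add (qt.integrable_mul (c0 t) fun x => abs_arctan_le_two _) i3]
    refine integral_congr_ae (Eventually.of_forall fun x => ?_)
    simp only [hF']
    ring
  have hk : t ^ (-c) = ((t ^ (c / 2)) ^ 2)⁻¹ := by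
    rw [← Real.rpow_natCast, ← Real.rpow_mul ht0.le, ← Real.rpow_neg ht0.le]
    norm_num
  have hκ : 0 < t ^ (c / 2) := by positivity
  have hb : ∀ f : ℝ → ℝ, (∀ s, f s ^ 2 * (1 + s ^ 2) ≤ 36) →
      |∫ x, u t x * f ((x + ε * t ^ n) * t ^ (-c))|
        ≤ (C + 36 * Real.pi) / 2 * t ^ (c / 2) := by
    intro f hf
    refine abs_integral_mul_le_of_sq_mul_le (r := ε * t ^ n) q0.integrable_sq (hC t ht2) hκ
      fun x => ?_
    rw [← hk]
    exact hf _
  have b3 := hb arctanD3 arctanD3_sq_mul_le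
  have b1 := hb arctanD1 arctanD1_sq_mul_le
  have b2 := hb (fun s => s * arctanD1 s) mul_arctanD1_sq_mul_le
  obtain ⟨k1, k2⟩ := hcoef t (by linarith)
  refine ⟨(t ^ (-c)) ^ 3 * (∫ x, u t x * arctanD3 ((x + ε * t ^ n) * t ^ (-c)))
      + (ε * n * t ^ (n - 1) * t ^ (-c) *
          (∫ x, u t x * arctanD1 ((x + ε * t ^ n) * t ^ (-c)))
        + -(c * t⁻¹) * ∫ x, u t x *
          ((x + ε * t ^ n) * t ^ (-c) * arctanD1 ((x + ε * t ^ n) * t ^ (-c)))),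
    key.2.congr_deriv (by rw [hsplit]; linarith), ?_⟩
  refine (abs_add_le _ _).trans ((add_le_add_right (abs_add_le _ _) _).trans ?_)
  rw [abs_mul, abs_mul _ (∫ x, u t x * arctanD1 _), abs_mul (-(c * t⁻¹)),
    abs_of_pos (by positivity : 0 < (t ^ (-c)) ^ 3)]
  have g3 := mul_le_mul_of_nonneg_left b3 (by positivity : 0 ≤ (t ^ (-c)) ^ 3)
  have g1 := mul_le_mul k1 b1 (abs_nonneg _) (by positivity)
  have g2 := mul_le_mul k2 b2 (abs_nonneg _) (by positivity)
  linarith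

/-- A bounded function on a half-line cannot have derivative bounded below by `d / t` up to an
integrable power. -/
theorem not_bounded_of_deriv_ge {J J' : ℝ → ℝ} {T d K M δ : ℝ} (hT : 0 < T) (hd : 0 < d)
    (hδ : 0 < δ) (hK : 0 ≤ K) (hJ : ∀ t, T ≤ t → HasDerivAt J (J' t) t)
    (hJ' : ∀ t, T ≤ t → d * t⁻¹ - K * t ^ (-1 - δ) ≤ J' t) (hM : ∀ t, T ≤ t → J t ≤ M) :
    False := by
  set H : ℝ → ℝ := fun t => J t - d * Real.log t - K / δ * t ^ (-δ) with hH
  have hder : ∀ t, T ≤ t → HasDerivAt H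
      (J' t - d * t⁻¹ - K / δ * (-δ * t ^ (-δ - 1))) t := by
    intro t ht
    have ht0 : 0 < t := hT.trans_le ht
    exact ((hJ t ht).sub ((Real.hasDerivAt_log ht0.ne').const_mul d)).sub
      ((Real.hasDerivAt_rpow_const (p := -δ) (Or.inl ht0.ne')).const_mul (K / δ))
  have hmono : MonotoneOn H (Set.Ici T) := by
    refine monotoneOn_of_deriv_nonneg (convex_Ici T)
      (fun t ht => (hder t ht).continuousAt.continuousWithinAt)
      (fun t ht => (hder t (interior_subset ht)).differentiableAt.differentiableWithinAt) ?_
    intro t ht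
    have ht' : T ≤ t := interior_subset ht
    rw [(hder t ht').deriv]
    have h1 := hJ' t ht'
    have h2 : K / δ * (-δ * t ^ (-δ - 1)) = -(K * t ^ (-1 - δ)) := by
      rw [show -δ - 1 = -1 - δ by ring]
      field_simp
    linarith
  obtain ⟨t, ht, htT⟩ := (((Real.tendsto_log_atTop.const_mul_atTop hd).eventually_gt_atTop
    (M - H T)).and (eventually_ge_atTop T)).exists
  have h1 : H T ≤ H t := hmono Set.self_mem_Ici htT htT
  have h2 : 0 ≤ K / δ * t ^ (-δ) := by
    have : 0 < t := hT.trans_le htT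
    positivity
  have h3 := hM t htT
  simp only [hH] at h1 ht
  linarith

theorem setIntegral_sq_le_two_mul {U : ℝ → ℝ} (hU : QuadDecay U) (r k : ℝ) {S : Set ℝ}
    (hS : MeasurableSet S) (h : ∀ x ∈ S, |(x + r) * k| ≤ 1) :
    ∫ x in S, U x ^ 2 ≤ 2 * ∫ x, U x ^ 2 * arctanD1 ((x + r) * k) := by
  have hc : Continuous fun x => arctanD1 ((x + r) * k) :=
    continuous_arctanD1.comp (by fun_prop)
  have hI := (hU.sq.integrable_mul hc fun x => abs_arctanD1_le _).const_mul 2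
  rw [← integral_const_mul]
  refine (setIntegral_mono_on hU.integrable_sq.integrableOn hI.integrableOn hS
    fun x hx => ?_).trans (setIntegral_le_integral hI (Eventually.of_forall fun x => ?_))
  · have h1 := one_add_sq_mul_arctanD1 ((x + r) * k)
    have h2 : ((x + r) * k) ^ 2 ≤ 1 := (sq_le_one_iff_abs_le_one _).2 (h x hx)
    have h3 := arctanD1_pos ((x + r) * k)
    have h4 : 1 ≤ 2 * arctanD1 ((x + r) * k) := by nlinarith
    nlinarith [sq_nonneg (U x)]
  · have := arctanD1_pos ((x + r) * k)
    simp only [Pi.zero_apply]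
    positivity

/-- Local decay for the quadratic KdV equation (`p = 2`):
`liminf_{t→∞} ∫_{Ω(t)} u(t,x)² dx = 0` where `Ω(t) = {x : |x + ε₀ t^n| < t^b}`. -/
theorem kdv_quadratic_liminf_decay
    (b n ε₀ : ℝ) (hb₁ : 0 < b) (hb₂ : b < 2/3) (hn₁ : 0 ≤ n) (hn₂ : n < 1 - b/2)
    (hε₀ : ε₀ = -1 ∨ ε₀ = 1)
    (u : ℝ → ℝ → ℝ) (hu : IsAdmissibleGKdV 2 u)
    (hL2 : ∃ C : ℝ, ∀ t : ℝ, 2 ≤ t → (∫ x : ℝ, (u t x)^2) ≤ C) :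
    Filter.liminf
      (fun t : ℝ => ∫ x in {x : ℝ | |x + ε₀ * t ^ n| < t ^ b}, (u t x)^2)
      Filter.atTop = 0 := by
  obtain ⟨C, hC⟩ := hL2
  have hε : |ε₀| = 1 := by rcases hε₀ with h | h <;> simp [h]
  set g : ℝ → ℝ := fun t => ∫ x in {x : ℝ | |x + ε₀ * t ^ n| < t ^ b}, (u t x) ^ 2 with hg
  have hg0 : ∀ t, 0 ≤ g t := fun t => integral_nonneg fun x => sq_nonneg _
  have hq : ∀ t, 2 ≤ t → QuadDecay (u t) := fun t ht => hu.quadDecay [] ht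
  have hgC : ∀ t, 2 ≤ t → g t ≤ C := fun t ht =>
    (setIntegral_le_integral (hq t ht).integrable_sq
      (Eventually.of_forall fun x => sq_nonneg _)).trans (hC t ht)
  have hbdd : IsBoundedUnder (· ≥ ·) atTop g := isBoundedUnder_of ⟨0, hg0⟩
  have hcob : IsCoboundedUnder (· ≥ ·) atTop g :=
    IsBoundedUnder.isCoboundedUnder_ge
      ⟨C, eventually_map.2 ((eventually_ge_atTop 2).mono hgC)⟩
  refine le_antisymm (not_lt.1 fun hpos => ?_)
    (le_liminf_of_le hcob (Eventually.of_forall hg0))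
  obtain ⟨T₀, hT₀⟩ := eventually_atTop.1
    (eventually_lt_of_lt_liminf (half_lt_self hpos) hbdd)
  set L := liminf g atTop with hL
  set m : ℝ := 1 - b / 2 with hm
  set M : ℝ := (C + 36 * Real.pi) / 2 with hMdef
  have hC0 : 0 ≤ C := (hg0 2).trans (hgC 2 le_rfl)
  have hM0 : 0 ≤ M := by positivity
  obtain ⟨δ, hδ, hδ1, hδ2, hδ3⟩ : ∃ δ : ℝ, 0 < δ ∧ δ ≤ 1 / 2 - 3 * b / 4 ∧ δ ≤ 3 * b / 2 ∧
      δ ≤ 1 - n - b / 2 :=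
    ⟨min (1 / 2 - 3 * b / 4) (min (3 * b / 2) (1 - n - b / 2)),
      lt_min (by linarith) (lt_min (by linarith) (by linarith)), min_le_left _ _,
      (min_le_right _ _).trans (min_le_left _ _), (min_le_right _ _).trans (min_le_right _ _)⟩
  set V : ℝ → ℝ → ℝ := fun c τ => ∫ x, u τ x * Real.arctan ((x + ε₀ * τ ^ n) * τ ^ (-c)) with hV
  set W : ℝ → ℝ → ℝ := fun c t =>
    ∫ x, u t x ^ 2 * arctanD1 ((x + ε₀ * t ^ n) * t ^ (-c)) with hW
  have hVb : ∀ t, 2 ≤ t → |V b t - V m t| ≤ M * t ^ (m / 2) := by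
    intro t ht
    have ht0 : 0 < t := by linarith
    have hc : ∀ c : ℝ, Continuous fun x => Real.arctan ((x + ε₀ * t ^ n) * t ^ (-c)) :=
      fun c => Real.continuous_arctan.comp (by fun_prop)
    have hi : ∀ c : ℝ, Integrable fun x =>
        u t x * Real.arctan ((x + ε₀ * t ^ n) * t ^ (-c)) :=
      fun c => (hq t ht).integrable_mul (hc c) fun x => abs_arctan_le_two _
    have hk : t ^ (-m) = ((t ^ (m / 2)) ^ 2)⁻¹ := by
      rw [← Real.rpow_natCast, ← Real.rpow_mul ht0.le, ← Real.rpow_neg ht0.le]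
      norm_num
    have e : V b t - V m t = ∫ x, u t x * (Real.arctan ((x + ε₀ * t ^ n) * t ^ (-b))
        - Real.arctan ((x + ε₀ * t ^ n) * t ^ (-m))) := by
      simp only [hV]
      rw [← integral_sub (hi b) (hi m)]
      simp only [mul_sub]
    rw [e]
    refine abs_integral_mul_le_of_sq_mul_le (r := ε₀ * t ^ n) (hq t ht).integrable_sq (hC t ht)
      (by positivity) fun x => ?_
    rw [← hk]
    exact arctan_sub_sq_mul_le (by positivity)
      (Real.rpow_le_rpow_of_exponent_le (by linarith) (by linarith))
  have hE : ∀ c : ℝ, 0 ≤ c → c ≤ 1 → ∀ t : ℝ, ∃ E : ℝ, 3 < t →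
      HasDerivAt (V c) (t ^ (-c) * W c t + E) t ∧
      |E| ≤ M * t ^ (c / 2) * ((t ^ (-c)) ^ 3 + t ^ (n - 1) * t ^ (-c) + t⁻¹) := by
    intro c hc₀ hc₁ t
    by_cases ht : 3 < t
    · obtain ⟨E, h⟩ := hu.exists_hasDerivAt_moment hC hε hn₁ (by linarith) hc₀ hc₁ ht
      exact ⟨E, fun _ => h⟩
    · exact ⟨0, fun h => absurd h ht⟩
  choose E₁ hE₁ using hE b (by linarith) (by linarith)
  choose E₂ hE₂ using hE m (by linarith) (by linarith)
  refine not_bounded_of_deriv_ge (J := fun t => t ^ (b - 1) * (V b t - V m t))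
    (J' := fun t => (b - 1) * t ^ (b - 1 - 1) * (V b t - V m t) +
      t ^ (b - 1) * (t ^ (-b) * W b t + E₁ t - (t ^ (-m) * W m t + E₂ t)))
    (T := max T₀ 4) (d := L / 4) (K := 7 * M + C) (M := M) (δ := δ)
    (lt_max_of_lt_right (by norm_num)) (by linarith) hδ (by positivity) ?_ ?_ ?_
  · intro t ht
    have ht4 : 4 ≤ t := (le_max_right _ _).trans ht
    exact (Real.hasDerivAt_rpow_const (Or.inl (by linarith))).mul
      ((hE₁ t (by linarith)).1.sub (hE₂ t (by linarith)).1)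
  · intro t ht
    have ht4 : 4 ≤ t := (le_max_right _ _).trans ht
    have ht0 : 0 < t := by linarith
    have hgL : L / 2 < g t := hT₀ t ((le_max_left _ _).trans ht)
    have hpow : ∀ e : ℝ, e ≤ -1 - δ → t ^ e ≤ t ^ (-1 - δ) := fun e he =>
      Real.rpow_le_rpow_of_exponent_le (by linarith) he
    have hWb : g t ≤ 2 * W b t := by
      refine setIntegral_sq_le_two_mul (hq t (by linarith)) (ε₀ * t ^ n) (t ^ (-b)) ?_ ?_
      · exact (isOpen_lt (by fun_prop) continuous_const).measurableSet
      · intro x hx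
        have hx' : |x + ε₀ * t ^ n| < t ^ b := hx
        rw [abs_mul, abs_of_pos (by positivity : 0 < t ^ (-b)), Real.rpow_neg ht0.le,
          ← div_eq_mul_inv, div_le_one (by positivity)]
        exact hx'.le
    have hWm : W m t ≤ C := by
      have hc : Continuous fun x => arctanD1 ((x + ε₀ * t ^ n) * t ^ (-m)) :=
        continuous_arctanD1.comp (by fun_prop)
      refine (integral_mono ((hq t (by linarith)).sq.integrable_mul hc fun x =>
        abs_arctanD1_le _) (hq t (by linarith)).integrable_sq fun x => ?_).trans
        (hC t (by linarith))
      exact mul_le_of_le_one_right (sq_nonneg _) (arctanD1_le_one _)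
    have herr : ∀ c : ℝ, b ≤ c → c ≤ m → ∀ E : ℝ,
        |E| ≤ M * t ^ (c / 2) * ((t ^ (-c)) ^ 3 + t ^ (n - 1) * t ^ (-c) + t⁻¹) →
        |t ^ (b - 1) * E| ≤ 3 * M * t ^ (-1 - δ) := by
      intro c hc1 hc2 E hE
      rw [abs_mul, abs_of_pos (by positivity : 0 < t ^ (b - 1))]
      have e1 : t ^ (b - 1) * (t ^ (c / 2) * (t ^ (-c)) ^ 3)
          = t ^ (b - 1 + (c / 2 + -c * (3 : ℕ))) := by
        rw [Real.rpow_add ht0, Real.rpow_add ht0, Real.rpow_mul_natCast ht0.le]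
      have e2 : t ^ (b - 1) * (t ^ (c / 2) * (t ^ (n - 1) * t ^ (-c)))
          = t ^ (b - 1 + (c / 2 + (n - 1 + -c))) := by
        rw [Real.rpow_add ht0, Real.rpow_add ht0, Real.rpow_add ht0]
      have e3 : t ^ (b - 1) * (t ^ (c / 2) * t⁻¹) = t ^ (b - 1 + (c / 2 + -1)) := by
        rw [Real.rpow_add ht0, Real.rpow_add ht0, Real.rpow_neg_one]
      have p1 := hpow (b - 1 + (c / 2 + -c * (3 : ℕ))) (by push_cast; linarith)
      have p2 := hpow (b - 1 + (c / 2 + (n - 1 + -c))) (by linarith)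
      have p3 := hpow (b - 1 + (c / 2 + -1)) (by linarith)
      rw [← e1] at p1
      rw [← e2] at p2
      rw [← e3] at p3
      calc t ^ (b - 1) * |E| ≤ t ^ (b - 1) * (M * t ^ (c / 2) *
            ((t ^ (-c)) ^ 3 + t ^ (n - 1) * t ^ (-c) + t⁻¹)) := by gcongr
        _ = M * (t ^ (b - 1) * (t ^ (c / 2) * (t ^ (-c)) ^ 3)
            + t ^ (b - 1) * (t ^ (c / 2) * (t ^ (n - 1) * t ^ (-c)))
            + t ^ (b - 1) * (t ^ (c / 2) * t⁻¹)) := by ring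
        _ ≤ M * (t ^ (-1 - δ) + t ^ (-1 - δ) + t ^ (-1 - δ)) := by gcongr
        _ = _ := by ring
    have h1 := abs_le.1 (herr b le_rfl (by linarith) _ (hE₁ t (by linarith)).2)
    have h2 := abs_le.1 (herr m (by linarith) le_rfl _ (hE₂ t (by linarith)).2)
    have h3 : |(b - 1) * t ^ (b - 1 - 1) * (V b t - V m t)| ≤ M * t ^ (-1 - δ) := by
      rw [abs_mul, abs_mul, abs_of_pos (by positivity : 0 < t ^ (b - 1 - 1))]
      have hb : |b - 1| ≤ 1 := by rw [abs_le]; constructor <;> linarith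
      have e : t ^ (b - 1 - 1) * t ^ (m / 2) = t ^ (b - 1 - 1 + m / 2) :=
        (Real.rpow_add ht0 _ _).symm
      have p := hpow (b - 1 - 1 + m / 2) (by linarith)
      rw [← e] at p
      calc |b - 1| * t ^ (b - 1 - 1) * |V b t - V m t|
          ≤ 1 * t ^ (b - 1 - 1) * (M * t ^ (m / 2)) := by
            gcongr
            exact hVb t (by linarith)
        _ = M * (t ^ (b - 1 - 1) * t ^ (m / 2)) := by ring
        _ ≤ _ := by gcongr
    have h4 : t ^ (b - 1) * (t ^ (-m) * W m t) ≤ C * t ^ (-1 - δ) := by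
      have e : t ^ (b - 1) * t ^ (-m) = t ^ (b - 1 + -m) := (Real.rpow_add ht0 _ _).symm
      have p := hpow (b - 1 + -m) (by linarith)
      rw [← e] at p
      calc t ^ (b - 1) * (t ^ (-m) * W m t) ≤ t ^ (b - 1) * (t ^ (-m) * C) := by gcongr
        _ = C * (t ^ (b - 1) * t ^ (-m)) := by ring
        _ ≤ _ := by gcongr
    have h5 : t ^ (b - 1) * (t ^ (-b) * W b t) = t⁻¹ * W b t := by
      rw [← mul_assoc, ← Real.rpow_add ht0, ← Real.rpow_neg_one]
      congr 2
      ring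
    have h6 : L / 4 * t⁻¹ ≤ t⁻¹ * W b t := by
      rw [mul_comm]
      gcongr
      linarith
    have h3' := abs_le.1 h3
    linarith [h1.1, h2.2, h3'.1]
  · intro t ht
    have ht4 : 4 ≤ t := (le_max_right _ _).trans ht
    have ht0 : 0 < t := by linarith
    have e : t ^ (b - 1) * t ^ (m / 2) = t ^ (b - 1 + m / 2) := (Real.rpow_add ht0 _ _).symm
    have p : t ^ (b - 1 + m / 2) ≤ 1 :=
      Real.rpow_le_one_of_one_le_of_nonpos (by linarith) (by linarith)
    rw [← e] at p
    calc t ^ (b - 1) * (V b t - V m t) ≤ t ^ (b - 1) * (M * t ^ (m / 2)) := by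
          gcongr
          exact (le_abs_self _).trans (hVb t (by linarith))
      _ = M * (t ^ (b - 1) * t ^ (m / 2)) := by ring
      _ ≤ M * 1 := by gcongr
      _ = M := mul_one M
end
end
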